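/- Let R be a commutative noetherian ring and C a semidualizing R-module, and let n ≥ 1. Then G^n(GF_C(R) ∩ B_C(R)) = GF_C(R) ∩ B_C(R); that is, an R-module lies in the n-fold iterate G^n applied to the class of R-modules that are both G_C-flat and in the Bass class B_C(R) if and only if it is itself G_C-flat and in B_C(R). -/

import Mathlib

open CategoryTheory TensorProduct

universe u

section
variable (R : Type u) [CommRing R]

def extZero (M N : ModuleCat.{u} R) : Prop :=
  ∀ i : ℕ, 1 ≤ i → Subsingleton (((Ext R (ModuleCat.{u} R) i).obj (Opposite.op M)).obj N)

def torZero (M N : ModuleCat.{u} R) : Prop :=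
  ∀ i : ℕ, 1 ≤ i → Subsingleton (((Tor (ModuleCat.{u} R) i).obj M).obj N)

def IsSemidualizing (C : ModuleCat.{u} R) : Prop :=
  Module.Finite R C ∧ Function.Bijective (LinearMap.lsmul R C) ∧ extZero R C C

/-- A module is `C`-flat if it is isomorphic to `F ⊗[R] C` with `F` flat. -/
def IsCFlat (C M : ModuleCat.{u} R) : Prop :=
  ∃ F : ModuleCat.{u} R, Module.Flat R F ∧ Nonempty (M ≃ₗ[R] (F ⊗[R] C))

def IsCInjective (C M : ModuleCat.{u} R) : Prop :=
  ∃ I : ModuleCat.{u} R, Module.Injective R I ∧ Nonempty (M ≃ₗ[R] (↥C →ₗ[R] ↥I))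

/-- cotorsion: `Ext^{≥1}(F, N) = 0` for all flat `F`. -/
def IsCotorsion (N : ModuleCat.{u} R) : Prop :=
  ∀ F : ModuleCat.{u} R, Module.Flat R F → extZero R F N

/-- `C`-cotorsion: `Ext^{≥1}(F ⊗ C, N) = 0` for all flat `F`. -/
def IsCCotorsion (C N : ModuleCat.{u} R) : Prop :=
  ∀ F : ModuleCat.{u} R, Module.Flat R F →
    extZero R (ModuleCat.of R (↥F ⊗[R] ↥C)) N

/-- `C`-flat `C`-cotorsion: isomorphic to `F ⊗ C` with `F` flat and cotorsion. -/
def IsCFlatCotorsion (C M : ModuleCat.{u} R) : Prop :=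
  ∃ F : ModuleCat.{u} R, Module.Flat R F ∧ IsCotorsion R F ∧
    Nonempty (M ≃ₗ[R] (F ⊗[R] C))

/-- The natural evaluation map `C ⊗ Hom(C,M) → M`. -/
noncomputable def evalMap (C M : ModuleCat.{u} R) :
    (↥C ⊗[R] (↥C →ₗ[R] ↥M)) →ₗ[R] ↥M :=
  TensorProduct.lift (LinearMap.id (R := R) (M := ↥C →ₗ[R] ↥M)).flip

/-- The Bass class `B_C(R)`. -/
noncomputable def InBassClass (C M : ModuleCat.{u} R) : Prop :=
  extZero R C M ∧
  torZero R C (ModuleCat.of R (↥C →ₗ[R] ↥M)) ∧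
  Function.Bijective (evalMap R C M)

/-- A `ℤ`-indexed complex of `R`-modules: `d i : X (i+1) → X i`. -/
structure ZComplex where
  X : ℤ → ModuleCat.{u} R
  d : ∀ i : ℤ, ↥(X (i + 1)) →ₗ[R] ↥(X i)
  d_comp_d : ∀ i : ℤ, (d i).comp (d (i + 1)) = 0

namespace ZComplex

variable {R} (Z : ZComplex R)

/-- Exactness of the complex. -/
def IsExact : Prop := ∀ i : ℤ, Function.Exact (Z.d (i + 1)) (Z.d i)

/-- Exactness of `Z ⊗[R] J`. -/
def TensorExact (J : ModuleCat.{u} R) : Prop :=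
  ∀ i : ℤ, Function.Exact (LinearMap.rTensor (↥J) (Z.d (i + 1)))
    (LinearMap.rTensor (↥J) (Z.d i))

/-- Exactness of `Hom_R(V, Z)`. -/
def HomFromExact (V : ModuleCat.{u} R) : Prop :=
  ∀ i : ℤ, Function.Exact
    (fun f : ↥V →ₗ[R] ↥(Z.X (i + 1 + 1)) => (Z.d (i + 1)).comp f)
    (fun f : ↥V →ₗ[R] ↥(Z.X (i + 1)) => (Z.d i).comp f)

/-- Exactness of `Hom_R(Z, V)`. -/
def HomToExact (V : ModuleCat.{u} R) : Prop :=
  ∀ i : ℤ, Function.Exact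
    (fun g : ↥(Z.X i) →ₗ[R] ↥V => g.comp (Z.d i))
    (fun g : ↥(Z.X (i + 1)) →ₗ[R] ↥V => g.comp (Z.d (i + 1)))

/-- `M ≅ Coker(∂₁)`. -/
def IsCokerOfD1 (M : ModuleCat.{u} R) : Prop :=
  Nonempty (↥M ≃ₗ[R] (↥(Z.X 0) ⧸ LinearMap.range (Z.d 0)))

end ZComplex

end

section
variable (R : Type u) [CommRing R]

/-- A complete `FF_C`-resolution witnessing that `M` is `G_C`-flat. -/
def IsGCFlat (C M : ModuleCat.{u} R) : Prop :=
  ∃ Z : ZComplex R, Z.IsExact ∧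
    (∀ i : ℤ, 0 ≤ i → Module.Flat R (Z.X i)) ∧
    (∀ i : ℤ, i < 0 → IsCFlat R C (Z.X i)) ∧
    (∀ J : ModuleCat.{u} R, IsCInjective R C J → Z.TensorExact J) ∧
    Z.IsCokerOfD1 M

def IsCProjective (C M : ModuleCat.{u} R) : Prop :=
  ∃ P : ModuleCat.{u} R, Module.Projective R P ∧ Nonempty (M ≃ₗ[R] (P ⊗[R] C))

/-- A complete `PP_C`-resolution witnessing that `M` is `G_C`-projective. -/
def IsGCProjective (C M : ModuleCat.{u} R) : Prop :=
  ∃ Z : ZComplex R, Z.IsExact ∧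
    (∀ i : ℤ, 0 ≤ i → Module.Projective R (Z.X i)) ∧
    (∀ i : ℤ, i < 0 → IsCProjective R C (Z.X i)) ∧
    (∀ Q : ModuleCat.{u} R, IsCProjective R C Q → Z.HomToExact Q) ∧
    Z.IsCokerOfD1 M

/-- `G(𝒳)` for a class `𝒳` of modules. -/
def GClass (𝒳 : ModuleCat.{u} R → Prop) (M : ModuleCat.{u} R) : Prop :=
  ∃ Z : ZComplex R, Z.IsExact ∧
    (∀ i : ℤ, 𝒳 (Z.X i)) ∧
    (∀ V : ModuleCat.{u} R, 𝒳 V → Z.HomFromExact V) ∧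
    (∀ V : ModuleCat.{u} R, 𝒳 V → Z.HomToExact V) ∧
    Z.IsCokerOfD1 M

/-- Iterates `G^n(𝒳)`, with `G^0(𝒳) = 𝒳`. -/
def GIter : ℕ → (ModuleCat.{u} R → Prop) → (ModuleCat.{u} R → Prop)
  | 0, 𝒳 => 𝒳
  | n + 1, 𝒳 => GClass R (GIter n 𝒳)

/-- `H_C(𝒳)`: modules with a `P_C F_C^cot`-complete `𝒳`-resolution. -/
def HClass (C : ModuleCat.{u} R) (𝒳 : ModuleCat.{u} R → Prop) (M : ModuleCat.{u} R) : Prop :=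
  ∃ Z : ZComplex R, Z.IsExact ∧
    (∀ i : ℤ, 𝒳 (Z.X i)) ∧
    (∀ P : ModuleCat.{u} R, Module.Projective R P →
      Z.HomFromExact (ModuleCat.of R (↥P ⊗[R] ↥C))) ∧
    (∀ N : ModuleCat.{u} R, IsCFlatCotorsion R C N → Z.HomToExact N) ∧
    Z.IsCokerOfD1 M

/-- Iterates `H_C^n(𝒳)`, with `H_C^0(𝒳) = 𝒳`. -/
def HIter (C : ModuleCat.{u} R) : ℕ → (ModuleCat.{u} R → Prop) → (ModuleCat.{u} R → Prop)
  | 0, 𝒳 => 𝒳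
  | n + 1, 𝒳 => HClass R C (HIter C n 𝒳)

/-- `M` admits a resolution `0 → X_n → ⋯ → X_0 → M → 0` with each `X_i` in `𝒳`. -/
def HasResOfLength (𝒳 : ModuleCat.{u} R → Prop) (n : ℕ) (M : ModuleCat.{u} R) : Prop :=
  ∃ (P : ℕ → ModuleCat.{u} R) (d : ∀ i : ℕ, ↥(P (i + 1)) →ₗ[R] ↥(P i))
    (ε : ↥(P 0) →ₗ[R] ↥M),
      Function.Surjective ε ∧ Function.Exact (d 0) ε ∧
      (∀ i : ℕ, Function.Exact (d (i + 1)) (d i)) ∧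
      (∀ i : ℕ, i ≤ n → 𝒳 (P i)) ∧
      (∀ i : ℕ, n < i → Subsingleton (P i))

/-- `M` admits a coresolution `0 → M → Y_0 → ⋯ → Y_n → 0` with each `Y_i` in `𝒳`. -/
def HasCoresOfLength (𝒳 : ModuleCat.{u} R → Prop) (n : ℕ) (M : ModuleCat.{u} R) : Prop :=
  ∃ (P : ℕ → ModuleCat.{u} R) (d : ∀ i : ℕ, ↥(P i) →ₗ[R] ↥(P (i + 1)))
    (η : ↥M →ₗ[R] ↥(P 0)),
      Function.Injective η ∧ Function.Exact η (d 0) ∧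
      (∀ i : ℕ, Function.Exact (d i) (d (i + 1))) ∧
      (∀ i : ℕ, i ≤ n → 𝒳 (P i)) ∧
      (∀ i : ℕ, n < i → Subsingleton (P i))

/-- `C` is a dualizing module: semidualizing of finite injective dimension. -/
def IsDualizing (C : ModuleCat.{u} R) : Prop :=
  IsSemidualizing R C ∧
  ∃ n : ℕ, HasCoresOfLength R (fun I => Module.Injective R ↥I) n C

end

section ExtVanish

variable {R : Type u} [CommRing R]

/-- Short exact sequences `0 → A → B → D → 0` of modules. -/
structure IsSES {A B D : Type u} [AddCommGroup A] [AddCommGroup B] [AddCommGroup D]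
    [Module R A] [Module R B] [Module R D] (f : A →ₗ[R] B) (g : B →ₗ[R] D) : Prop where
  inj : Function.Injective f
  exact : Function.Exact f g
  surj : Function.Surjective g

variable (R) in
/-- `Ext^i(A, N) = 0` for all `i ≥ 1`. -/
def ExtVanish (A N : Type u) [AddCommGroup A] [AddCommGroup N] [Module R A] [Module R N] : Prop :=
  ∀ n : ℕ, Subsingleton (Abelian.Ext.{u} (ModuleCat.of R A) (ModuleCat.of R N) (n + 1))

variable {A B D N : Type u} [AddCommGroup A] [AddCommGroup B] [AddCommGroup D] [AddCommGroup N]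
  [Module R A] [Module R B] [Module R D] [Module R N]
  {f : A →ₗ[R] B} {g : B →ₗ[R] D}

namespace IsSES

/-- The associated short complex in `ModuleCat R`. -/
abbrev toShortComplex (h : IsSES f g) : ShortComplex (ModuleCat.{u} R) :=
  ShortComplex.mk (ModuleCat.ofHom f) (ModuleCat.ofHom g)
    (by rw [← ModuleCat.ofHom_comp, h.exact.linearMap_comp_eq_zero]; rfl)

theorem shortExact (h : IsSES f g) : h.toShortComplex.ShortExact where
  exact := (ShortComplex.ShortExact.moduleCat_exact_iff_function_exact _).2 h.exact
  mono_f := (ModuleCat.mono_iff_injective _).2 h.inj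
  epi_g := (ModuleCat.epi_iff_surjective _).2 h.surj

theorem ext_left_subsingleton_right (h : IsSES f g) (n : ℕ)
    (hA : Subsingleton (Abelian.Ext.{u} (ModuleCat.of R A) (ModuleCat.of R N) n))
    (hB : Subsingleton (Abelian.Ext.{u} (ModuleCat.of R B) (ModuleCat.of R N) (n + 1))) :
    Subsingleton (Abelian.Ext.{u} (ModuleCat.of R D) (ModuleCat.of R N) (n + 1)) := by
  refine subsingleton_of_forall_eq 0 fun x => ?_
  obtain ⟨y, rfl⟩ := Abelian.Ext.contravariant_sequence_exact₃ h.shortExact _ x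
    (hB.elim _ _) (add_comm 1 n)
  rw [show y = 0 from hA.elim _ _, Abelian.Ext.comp_zero]

theorem ext_left_subsingleton_middle (h : IsSES f g) (n : ℕ)
    (hA : Subsingleton (Abelian.Ext.{u} (ModuleCat.of R A) (ModuleCat.of R N) n))
    (hD : Subsingleton (Abelian.Ext.{u} (ModuleCat.of R D) (ModuleCat.of R N) n)) :
    Subsingleton (Abelian.Ext.{u} (ModuleCat.of R B) (ModuleCat.of R N) n) := by
  refine subsingleton_of_forall_eq 0 fun x => ?_
  obtain ⟨y, rfl⟩ := Abelian.Ext.contravariant_sequence_exact₂ h.shortExact _ x (hA.elim _ _)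
  rw [show y = 0 from hD.elim _ _, Abelian.Ext.comp_zero]

theorem ext_left_subsingleton_left (h : IsSES f g) (n : ℕ)
    (hB : Subsingleton (Abelian.Ext.{u} (ModuleCat.of R B) (ModuleCat.of R N) n))
    (hD : Subsingleton (Abelian.Ext.{u} (ModuleCat.of R D) (ModuleCat.of R N) (n + 1))) :
    Subsingleton (Abelian.Ext.{u} (ModuleCat.of R A) (ModuleCat.of R N) n) := by
  refine subsingleton_of_forall_eq 0 fun x => ?_
  obtain ⟨y, rfl⟩ := Abelian.Ext.contravariant_sequence_exact₁ h.shortExact _ x (add_comm 1 n)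
    (hD.elim _ _)
  rw [show y = 0 from hB.elim _ _, Abelian.Ext.comp_zero]

theorem ext_right_subsingleton_left (h : IsSES f g) (n : ℕ)
    (hD : Subsingleton (Abelian.Ext.{u} (ModuleCat.of R N) (ModuleCat.of R D) n))
    (hB : Subsingleton (Abelian.Ext.{u} (ModuleCat.of R N) (ModuleCat.of R B) (n + 1))) :
    Subsingleton (Abelian.Ext.{u} (ModuleCat.of R N) (ModuleCat.of R A) (n + 1)) := by
  refine subsingleton_of_forall_eq 0 fun x => ?_
  obtain ⟨y, rfl⟩ := Abelian.Ext.covariant_sequence_exact₁ _ h.shortExact x (hB.elim _ _) rfl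
  rw [show y = 0 from hD.elim _ _, Abelian.Ext.zero_comp]

theorem ext_right_subsingleton_middle (h : IsSES f g) (n : ℕ)
    (hA : Subsingleton (Abelian.Ext.{u} (ModuleCat.of R N) (ModuleCat.of R A) n))
    (hD : Subsingleton (Abelian.Ext.{u} (ModuleCat.of R N) (ModuleCat.of R D) n)) :
    Subsingleton (Abelian.Ext.{u} (ModuleCat.of R N) (ModuleCat.of R B) n) := by
  refine subsingleton_of_forall_eq 0 fun x => ?_
  obtain ⟨y, rfl⟩ := Abelian.Ext.covariant_sequence_exact₂ _ h.shortExact x (hD.elim _ _)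
  rw [show y = 0 from hA.elim _ _, Abelian.Ext.zero_comp]

/-- If `Ext^1(D, N) = 0` then maps `A → N` extend to `B`. -/
theorem exists_extension (h : IsSES f g) (hD : ExtVanish R D N) (a : A →ₗ[R] N) :
    ∃ b : B →ₗ[R] N, b.comp f = a := by
  obtain ⟨y, hy⟩ := Abelian.Ext.contravariant_sequence_exact₁ h.shortExact (ModuleCat.of R N)
    (Abelian.Ext.mk₀ (ModuleCat.ofHom a)) (add_comm 1 0) ((hD 0).elim _ _)
  obtain ⟨b, rfl⟩ := (Abelian.Ext.mk₀_bijective _ _).2 y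
  rw [Abelian.Ext.mk₀_comp_mk₀] at hy
  exact ⟨b.hom, congrArg ModuleCat.Hom.hom ((Abelian.Ext.mk₀_bijective _ _).1 hy)⟩

/-- If `Ext^1(B, N) = 0` and maps `A → N` extend to `B` then `Ext^1(D, N) = 0`. -/
theorem ext_one_left (h : IsSES f g) (hB : ExtVanish R B N)
    (hf : ∀ a : A →ₗ[R] N, ∃ b : B →ₗ[R] N, b.comp f = a) :
    Subsingleton (Abelian.Ext.{u} (ModuleCat.of R D) (ModuleCat.of R N) 1) := by
  refine subsingleton_of_forall_eq 0 fun x => ?_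
  obtain ⟨y, rfl⟩ := Abelian.Ext.contravariant_sequence_exact₃ h.shortExact _ x
    ((hB 0).elim _ _) (add_comm 1 0)
  obtain ⟨a, rfl⟩ := (Abelian.Ext.mk₀_bijective _ _).2 y
  obtain ⟨b, hb⟩ := hf a.hom
  have : a = h.toShortComplex.f ≫ ModuleCat.ofHom b := by
    ext1; exact hb.symm
  rw [this, ← Abelian.Ext.mk₀_comp_mk₀]
  exact h.shortExact.extClass_comp_assoc _

/-- If `Ext^1(N, B) = 0` and maps `N → D` lift to `B` then `Ext^1(N, A) = 0`. -/
theorem ext_one_right (h : IsSES f g) (hB : ExtVanish R N B)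
    (hf : ∀ a : N →ₗ[R] D, ∃ b : N →ₗ[R] B, g.comp b = a) :
    Subsingleton (Abelian.Ext.{u} (ModuleCat.of R N) (ModuleCat.of R A) 1) := by
  refine subsingleton_of_forall_eq 0 fun x => ?_
  obtain ⟨y, rfl⟩ := Abelian.Ext.covariant_sequence_exact₁ _ h.shortExact x
    ((hB 0).elim _ _) (zero_add 1)
  obtain ⟨a, rfl⟩ := (Abelian.Ext.mk₀_bijective _ _).2 y
  obtain ⟨b, hb⟩ := hf a.hom
  have : a = ModuleCat.ofHom b ≫ h.toShortComplex.g := by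
    ext1; exact hb.symm
  rw [this, ← Abelian.Ext.mk₀_comp_mk₀]
  rw [Abelian.Ext.comp_assoc_of_second_deg_zero, h.shortExact.comp_extClass, Abelian.Ext.comp_zero]

end IsSES

namespace ExtVanish

theorem of_projective [Module.Projective R A] : ExtVanish R A N := fun n =>
  have : Projective (ModuleCat.of R A) := (IsProjective.iff_projective _).1 inferInstance
  Abelian.Ext.subsingleton_of_projective _ _ n

theorem left_of_ses (h : IsSES f g) (hB : ExtVanish R B N) (hD : ExtVanish R D N) :
    ExtVanish R A N := fun n => h.ext_left_subsingleton_left _ (hB n) (hD (n + 1))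

theorem middle_of_ses (h : IsSES f g) (hA : ExtVanish R A N) (hD : ExtVanish R D N) :
    ExtVanish R B N := fun n => h.ext_left_subsingleton_middle _ (hA n) (hD n)

theorem middle_of_ses' (h : IsSES f g) (hA : ExtVanish R N A) (hD : ExtVanish R N D) :
    ExtVanish R N B := fun n => h.ext_right_subsingleton_middle _ (hA n) (hD n)

theorem of_subsingleton_left [Subsingleton A] : ExtVanish R A N :=
  of_projective

theorem of_linearEquiv_left (e : A ≃ₗ[R] B) (h : ExtVanish R A N) : ExtVanish R B N :=
  middle_of_ses (f := e.toLinearMap) (g := (0 : B →ₗ[R] PUnit.{u + 1}))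
    ⟨e.injective, fun b => ⟨fun _ => e.surjective b, fun _ => rfl⟩, fun _ => ⟨0, rfl⟩⟩ h
    of_subsingleton_left

theorem of_subsingleton_right [Subsingleton N] : ExtVanish R A N := fun n =>
  subsingleton_of_forall_eq 0 fun x => by
    have h0 : 𝟙 (ModuleCat.of R N) = 0 := by ext y; exact Subsingleton.elim _ _
    rw [← Abelian.Ext.comp_mk₀_id x, h0, Abelian.Ext.mk₀_zero, Abelian.Ext.comp_zero]

theorem of_linearEquiv_right (e : A ≃ₗ[R] B) (h : ExtVanish R N A) : ExtVanish R N B :=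
  middle_of_ses' (f := e.toLinearMap) (g := (0 : B →ₗ[R] PUnit.{u + 1}))
    ⟨e.injective, fun b => ⟨fun _ => e.surjective b, fun _ => rfl⟩, fun _ => ⟨0, rfl⟩⟩ h
    of_subsingleton_right

/-- Dimension shifting to the left. -/
theorem of_forall_presentation (P : ModuleCat.{u} R → Prop)
    (hP : ∀ D, P D → ∃ (A B : ModuleCat.{u} R) (f : A →ₗ[R] B) (g : B →ₗ[R] D),
      P A ∧ IsSES f g ∧ ExtVanish R B N ∧ ∀ a : A →ₗ[R] N, ∃ b : B →ₗ[R] N, b.comp f = a)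
    (M : ModuleCat.{u} R) (hM : P M) : ExtVanish R M N := by
  intro n
  induction n generalizing M with
  | zero =>
    obtain ⟨A, B, f, g, -, h, hB, hf⟩ := hP M hM
    exact h.ext_one_left hB hf
  | succ n ih =>
    obtain ⟨A, B, f, g, hA, h, hB, -⟩ := hP M hM
    exact h.ext_left_subsingleton_right _ (ih A hA) (hB (n + 1))

/-- Dimension shifting to the right. -/
theorem of_forall_copresentation (P : ModuleCat.{u} R → Prop)
    (hP : ∀ A, P A → ∃ (B D : ModuleCat.{u} R) (f : A →ₗ[R] B) (g : B →ₗ[R] D),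
      P D ∧ IsSES f g ∧ ExtVanish R N B ∧ ∀ a : N →ₗ[R] D, ∃ b : N →ₗ[R] B, g.comp b = a)
    (M : ModuleCat.{u} R) (hM : P M) : ExtVanish R N M := by
  intro n
  induction n generalizing M with
  | zero =>
    obtain ⟨B, D, f, g, -, h, hB, hf⟩ := hP M hM
    exact h.ext_one_right hB hf
  | succ n ih =>
    obtain ⟨B, D, f, g, hD, h, hB, -⟩ := hP M hM
    exact h.ext_right_subsingleton_left _ (ih D hD) (hB (n + 1))

end ExtVanish

end ExtVanish

section Cycles

variable {R : Type u} [CommRing R] {X Y Z N : Type u} [AddCommGroup X] [AddCommGroup Y]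
  [AddCommGroup Z] [AddCommGroup N] [Module R X] [Module R Y] [Module R Z] [Module R N]
  {d' : X →ₗ[R] Y} {d : Y →ₗ[R] Z}

/-- The map induced by `d` on the cokernel of the previous differential. -/
def cokerMap (h : Function.Exact d' d) : (Y ⧸ LinearMap.range d') →ₗ[R] Z :=
  (LinearMap.range d').liftQ d (LinearMap.exact_iff.1 h).ge

theorem cokerMap_comp_mkQ (h : Function.Exact d' d) :
    (cokerMap h).comp (LinearMap.range d').mkQ = d :=
  Submodule.liftQ_mkQ _ _ _

theorem isSES_cokerMap (h : Function.Exact d' d) :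
    IsSES (cokerMap h) (LinearMap.range d).mkQ where
  inj := by
    rw [← LinearMap.ker_eq_bot, cokerMap, Submodule.ker_liftQ, LinearMap.exact_iff.1 h]
    exact Submodule.mkQ_map_self _
  exact := by
    rw [LinearMap.exact_iff, Submodule.ker_mkQ, cokerMap, Submodule.range_liftQ]
  surj := Submodule.mkQ_surjective _

theorem hom_exact_iff (h : Function.Exact d' d) :
    Function.Exact (fun b : Z →ₗ[R] N => b.comp d) (fun a : Y →ₗ[R] N => a.comp d') ↔
      ∀ a : (Y ⧸ LinearMap.range d') →ₗ[R] N, ∃ b : Z →ₗ[R] N, b.comp (cokerMap h) = a := by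
  constructor
  · intro H a
    obtain ⟨b, hb⟩ := (H (a.comp (LinearMap.range d').mkQ)).1 (by
      change (a.comp _).comp d' = 0
      rw [LinearMap.comp_assoc, LinearMap.range_mkQ_comp, LinearMap.comp_zero])
    refine ⟨b, Submodule.linearMap_qext _ ?_⟩
    rw [LinearMap.comp_assoc, cokerMap_comp_mkQ]
    exact hb
  · intro H a
    constructor
    · intro ha
      obtain ⟨b, hb⟩ := H ((LinearMap.range d').liftQ a (LinearMap.range_le_ker_iff.2 ha))
      refine ⟨b, ?_⟩
      change b.comp d = a
      rw [← cokerMap_comp_mkQ h, ← LinearMap.comp_assoc, hb, Submodule.liftQ_mkQ]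
    · rintro ⟨b, rfl⟩
      change (b.comp d).comp d' = 0
      rw [LinearMap.comp_assoc, h.linearMap_comp_eq_zero, LinearMap.comp_zero]

theorem rTensor_exact_iff (h : Function.Exact d' d) :
    Function.Exact (d'.rTensor N) (d.rTensor N) ↔
      Function.Injective ((cokerMap h).rTensor N) := by
  have h1 : Function.Exact (d'.rTensor N) ((LinearMap.range d').mkQ.rTensor N) :=
    rTensor_exact N (LinearMap.exact_map_mkQ_range d') (Submodule.mkQ_surjective _)
  have h2 : d.rTensor N = (cokerMap h).rTensor N ∘ₗ (LinearMap.range d').mkQ.rTensor N := by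
    rw [← LinearMap.rTensor_comp, cokerMap_comp_mkQ]
  have h3 : Function.Surjective ((LinearMap.range d').mkQ.rTensor N) :=
    LinearMap.rTensor_surjective N (Submodule.mkQ_surjective _)
  rw [h2]
  constructor
  · intro H
    rw [injective_iff_map_eq_zero]
    intro t ht
    obtain ⟨y, rfl⟩ := h3 t
    exact (h1 y).2 ((H y).1 ht)
  · intro H
    exact h1.comp_injective _ H (map_zero _)

theorem rTensor_injective_iff_forall_exists {A B : Type u} [AddCommGroup A] [AddCommGroup B]
    [Module R A] [Module R B] {f : A →ₗ[R] B} :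
    Function.Injective (f.rTensor N) ↔
      ∀ a : A →ₗ[R] CharacterModule N, ∃ b : B →ₗ[R] CharacterModule N, b.comp f = a :=
  rTensor_injective_iff_lcomp_surjective

theorem lTensor_exact_iff_rTensor_exact :
    Function.Exact (d'.lTensor N) (d.lTensor N) ↔
      Function.Exact (d'.rTensor N) (d.rTensor N) := by
  refine Function.Exact.iff_of_ladder_linearEquiv (e₁ := TensorProduct.comm R X N)
    (e₂ := TensorProduct.comm R Y N) (e₃ := TensorProduct.comm R Z N) ?_ ?_
  · ext; rfl
  · ext; rfl

theorem lTensor_exact_iff (h : Function.Exact d' d) :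
    Function.Exact (d'.lTensor N) (d.lTensor N) ↔
      ∀ a : (Y ⧸ LinearMap.range d') →ₗ[R] CharacterModule N,
        ∃ b : Z →ₗ[R] CharacterModule N, b.comp (cokerMap h) = a := by
  rw [lTensor_exact_iff_rTensor_exact, rTensor_exact_iff h, rTensor_injective_iff_forall_exists]

end Cycles

section Derived

theorem exact_congr {A B D A' B' D' : Type*} [Zero D] [Zero D'] {f : A → B} {g : B → D}
    {f' : A' → B'} {g' : B' → D'} (eA : A ≃ A') (eB : B ≃ B') (eD : D ≃ D') (h0 : eD 0 = 0)
    (hf : ∀ a, eB (f a) = f' (eA a)) (hg : ∀ b, eD (g b) = g' (eB b)) :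
    Function.Exact f g ↔ Function.Exact f' g' := by
  rw [Function.Exact, Function.Exact, ← eB.forall_congr_right]
  refine forall_congr' fun b => ?_
  rw [← hg, ← h0, eD.apply_eq_iff_eq, Set.mem_range, Set.mem_range, ← eA.exists_congr_right]
  simp only [← hf, eB.apply_eq_iff_eq]

variable {R : Type u} [CommRing R]

theorem extVanish_iff_of_exact (P : ℕ → ModuleCat.{u} R) (d : ∀ n, P (n + 1) →ₗ[R] P n)
    (hP : ∀ n, Module.Projective R (P n)) (h : ∀ n, Function.Exact (d (n + 1)) (d n))
    (N : ModuleCat.{u} R) :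
    (∀ n, ∀ a : (P (n + 1) ⧸ LinearMap.range (d (n + 1))) →ₗ[R] N,
        ∃ b : P n →ₗ[R] N, b.comp (cokerMap (h n)) = a) ↔
      ExtVanish R (P 0 ⧸ LinearMap.range (d 0)) N := by
  constructor
  · intro H
    refine ExtVanish.of_forall_presentation
      (fun D => ∃ n, D = ModuleCat.of R (P n ⧸ LinearMap.range (d n))) ?_ (ModuleCat.of R _)
      ⟨0, rfl⟩
    rintro _ ⟨n, rfl⟩
    exact ⟨_, P n, cokerMap (h n), (LinearMap.range (d n)).mkQ, ⟨n + 1, rfl⟩,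
      isSES_cokerMap (h n), ExtVanish.of_projective, H n⟩
  · intro H
    have : ∀ n, ExtVanish R (P n ⧸ LinearMap.range (d n)) N := fun n => by
      induction n with
      | zero => exact H
      | succ n ih => exact ExtVanish.left_of_ses (isSES_cokerMap (h n)) ExtVanish.of_projective ih
    exact fun n => (isSES_cokerMap (h n)).exists_extension (this n)

variable {M : ModuleCat.{u} R} (P : ProjectiveResolution M)

theorem projectiveResolution_projective (n : ℕ) : Module.Projective R (P.complex.X n) :=
  (IsProjective.iff_projective _).2 (P.projective n)

theorem projectiveResolution_exact (n : ℕ) :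
    Function.Exact (P.complex.d (n + 2) (n + 1)).hom (P.complex.d (n + 1) n).hom :=
  (ShortComplex.ShortExact.moduleCat_exact_iff_function_exact _).1 (P.exact_succ n)

theorem projectiveResolution_coker :
    Nonempty (M ≃ₗ[R] (P.complex.X 0 ⧸ LinearMap.range (P.complex.d 1 0).hom)) := by
  have hex : Function.Exact (P.complex.d 1 0).hom (P.π.f 0).hom :=
    (ShortComplex.ShortExact.moduleCat_exact_iff_function_exact _).1 P.exact₀
  have hs : Function.Surjective (P.π.f 0).hom := (ModuleCat.epi_iff_surjective _).1 inferInstance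
  exact ⟨((Submodule.quotEquivOfEq _ _ (LinearMap.exact_iff.1 hex).symm).trans
    ((P.π.f 0).hom.quotKerEquivOfSurjective hs)).symm⟩

theorem extZero_iff (M N : ModuleCat.{u} R) : extZero R M N ↔ ExtVanish R M N := by
  let P := projectiveResolution M
  obtain ⟨e⟩ := projectiveResolution_coker P
  have key := extVanish_iff_of_exact (fun n => P.complex.X n)
    (fun n => (P.complex.d (n + 1) n).hom) (projectiveResolution_projective P)
    (projectiveResolution_exact P) N
  have : ExtVanish R M N ↔
      ExtVanish R (P.complex.X 0 ⧸ LinearMap.range (P.complex.d 1 0).hom) N :=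
    ⟨.of_linearEquiv_left e, .of_linearEquiv_left e.symm⟩
  rw [this, ← key]
  have step : ∀ n, Subsingleton (((Ext R (ModuleCat.{u} R) (n + 1)).obj (Opposite.op M)).obj N) ↔
      ∀ a : (P.complex.X (n + 1) ⧸ LinearMap.range (P.complex.d (n + 2) (n + 1)).hom) →ₗ[R] N,
        ∃ b : P.complex.X n →ₗ[R] N, b.comp (cokerMap (projectiveResolution_exact P n)) = a := by
    intro n
    rw [← ModuleCat.isZero_iff_subsingleton, (P.isoExt (n + 1) N).isZero_iff,
      ← HomologicalComplex.exactAt_iff_isZero_homology,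
      HomologicalComplex.exactAt_iff' _ n (n + 1) (n + 2) (by simp) (by simp),
      ShortComplex.ShortExact.moduleCat_exact_iff_function_exact, ← hom_exact_iff]
    let e : ∀ m, (P.complex.X m ⟶ N) ≃ (P.complex.X m →ₗ[R] N) := fun m => ModuleCat.homEquiv
    refine exact_congr (e n) (e (n + 1)) (e (n + 2)) rfl (fun a => ?_) (fun a => ?_) <;> rfl
  constructor
  · intro H n
    exact (step n).1 (H (n + 1) (by omega))
  · intro H i hi
    obtain ⟨n, rfl⟩ : ∃ n, i = n + 1 := ⟨i - 1, by omega⟩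
    exact (step n).2 (H n)

theorem torZero_iff (M N : ModuleCat.{u} R) :
    torZero R M N ↔ ExtVanish R N (CharacterModule M) := by
  let P := projectiveResolution N
  obtain ⟨e⟩ := projectiveResolution_coker P
  have key := extVanish_iff_of_exact (fun n => P.complex.X n)
    (fun n => (P.complex.d (n + 1) n).hom) (projectiveResolution_projective P)
    (projectiveResolution_exact P) (ModuleCat.of R (CharacterModule M))
  have : ExtVanish R N (CharacterModule M) ↔
      ExtVanish R (P.complex.X 0 ⧸ LinearMap.range (P.complex.d 1 0).hom) (CharacterModule M) :=
    ⟨.of_linearEquiv_left e, .of_linearEquiv_left e.symm⟩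
  rw [this]
  refine Iff.trans ?_ key
  have step : ∀ n, Subsingleton (((Tor (ModuleCat.{u} R) (n + 1)).obj M).obj N) ↔
      ∀ a : (P.complex.X (n + 1) ⧸ LinearMap.range (P.complex.d (n + 2) (n + 1)).hom) →ₗ[R]
          CharacterModule M,
        ∃ b : P.complex.X n →ₗ[R] CharacterModule M,
          b.comp (cokerMap (projectiveResolution_exact P n)) = a := by
    intro n
    rw [← ModuleCat.isZero_iff_subsingleton]
    refine (P.isoLeftDerivedObj ((MonoidalCategory.tensoringLeft _).obj M) (n + 1)).isZero_iff.trans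
      ((HomologicalComplex.exactAt_iff_isZero_homology _ _).symm.trans ?_)
    rw [HomologicalComplex.exactAt_iff' _ (n + 2) (n + 1) n (by simp) (by simp),
      ShortComplex.ShortExact.moduleCat_exact_iff_function_exact, ← lTensor_exact_iff]
    rfl
  constructor
  · intro H n
    exact (step n).1 (H (n + 1) (by omega))
  · intro H i hi
    obtain ⟨n, rfl⟩ : ∃ n, i = n + 1 := ⟨i - 1, by omega⟩
    exact (step n).2 (H n)

end Derived

section TensorHom

variable {R : Type u} [CommRing R]

section

variable {A B D E : Type u} [AddCommGroup A] [AddCommGroup B] [AddCommGroup D] [AddCommGroup E]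
  [Module R A] [Module R B] [Module R D] [Module R E] {f : A →ₗ[R] B} {g : B →ₗ[R] D}

theorem exists_extension_of_injective [hE : Module.Injective R E] (hf : Function.Injective f)
    (a : A →ₗ[R] E) : ∃ b : B →ₗ[R] E, b.comp f = a :=
  (hE.out f hf a).imp fun _ h => LinearMap.ext h

theorem lcomp_exact_of_injective [Module.Injective R E] (h : Function.Exact f g) :
    Function.Exact (g.lcomp R E) (f.lcomp R E) :=
  (hom_exact_iff h).2 (exists_extension_of_injective (isSES_cokerMap h).inj)

theorem lcomp_surjective_of_injective [Module.Injective R E] (hf : Function.Injective f) :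
    Function.Surjective (f.lcomp R E) :=
  exists_extension_of_injective hf

variable (R A E) in
/-- The evaluation map `k ⊗ φ ↦ (h ↦ φ (h k))`. -/
noncomputable def tensorHomEval (K : Type u) [AddCommGroup K] [Module R K] :
    K ⊗[R] (A →ₗ[R] E) →ₗ[R] ((K →ₗ[R] A) →ₗ[R] E) :=
  TensorProduct.lift ((LinearMap.llcomp R (K →ₗ[R] A) A E).flip.comp
    (LinearMap.id (R := R) (M := K →ₗ[R] A)).flip)

@[simp]
theorem tensorHomEval_tmul {K : Type u} [AddCommGroup K] [Module R K] (k : K) (φ : A →ₗ[R] E)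
    (h : K →ₗ[R] A) : tensorHomEval R A E K (k ⊗ₜ φ) h = φ (h k) := rfl

theorem tensorHomEval_naturality {K L : Type u} [AddCommGroup K] [Module R K] [AddCommGroup L]
    [Module R L] (p : K →ₗ[R] L) :
    ((p.lcomp R A).lcomp R E).comp (tensorHomEval R A E K) =
      (tensorHomEval R A E L).comp (p.rTensor (A →ₗ[R] E)) := by
  ext k φ h; rfl

theorem tensorHomEval_bijective_pi (n : ℕ) :
    Function.Bijective (tensorHomEval R A E (Fin n → R)) := by
  let i (j : Fin n) : A →ₗ[R] ((Fin n → R) →ₗ[R] A) :=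
    LinearMap.lcomp R A (LinearMap.proj j) ∘ₗ (LinearMap.ringLmapEquivSelf R R A).symm
  let inv : (((Fin n → R) →ₗ[R] A) →ₗ[R] E) →ₗ[R] (Fin n → R) ⊗[R] (A →ₗ[R] E) :=
    ∑ j, (TensorProduct.mk R _ _ (Pi.single j 1)).comp ((i j).lcomp R E)
  refine Function.bijective_iff_has_inverse.2 ⟨inv, fun x => ?_, fun φ => ?_⟩
  · induction x with
    | zero => simp
    | add x y hx hy => simp [hx, hy]
    | tmul k φ =>
      have : ∀ j, (tensorHomEval R A E _ (k ⊗ₜ φ)).comp (i j) = k j • φ := by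
        intro j; ext a; simp [i]
      have hk : ∑ j, Pi.single j (k j) = k := Finset.univ_sum_single k
      simp only [inv, LinearMap.sum_apply, LinearMap.comp_apply, LinearMap.lcomp_apply', this,
        TensorProduct.mk_apply]
      conv_rhs => rw [← hk, TensorProduct.sum_tmul]
      refine Finset.sum_congr rfl fun j _ => ?_
      rw [← TensorProduct.smul_tmul, ← Pi.single_smul, smul_eq_mul, mul_one]
  · ext h
    have : ∑ j, i j (h (Pi.single j 1)) = h := by
      ext j
      simp [i, Pi.single_apply]
    simp only [inv, LinearMap.sum_apply, LinearMap.comp_apply, map_sum, TensorProduct.mk_apply,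
      tensorHomEval_tmul, LinearMap.lcomp_apply']
    rw [← map_sum, this]

theorem tensorHomEval_bijective [Module.Injective R E] (K : Type u) [AddCommGroup K] [Module R K]
    [Module.FinitePresentation R K] : Function.Bijective (tensorHomEval R A E K) := by
  obtain ⟨n, m, p, q, hp, hq⟩ := Module.FinitePresentation.exists_fin' R K
  exact LinearMap.bijective_of_surjective_of_bijective_of_right_exact
    (q.rTensor (A →ₗ[R] E)) (p.rTensor (A →ₗ[R] E))
    ((q.lcomp R A).lcomp R E) ((p.lcomp R A).lcomp R E) _ _ _
    (tensorHomEval_naturality q) (tensorHomEval_naturality p)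
    (rTensor_exact _ hq hp)
    (lcomp_exact_of_injective (LinearMap.exact_lcomp_of_exact_of_surjective _ hq hp))
    (tensorHomEval_bijective_pi m).2 (tensorHomEval_bijective_pi n)
    (LinearMap.rTensor_surjective _ hp)
    (lcomp_surjective_of_injective (LinearMap.lcomp_injective_of_surjective p hp))

theorem lTensorHomToHomLTensor_naturality {F K L : Type u} [AddCommGroup F] [Module R F]
    [AddCommGroup K] [Module R K] [AddCommGroup L] [Module R L] (p : K →ₗ[R] L) :
    (p.lcomp R (F ⊗[R] A)).comp (lTensorHomToHomLTensor (.id R) L F A) =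
      (lTensorHomToHomLTensor (.id R) K F A).comp ((p.lcomp R A).lTensor F) := by
  ext x h k; rfl

theorem lTensorHomToHomLTensor_bijective (F K A : Type u) [AddCommGroup F] [Module R F]
    [AddCommGroup K] [Module R K] [AddCommGroup A] [Module R A]
    [Module.Flat R F] [Module.FinitePresentation R K] :
    Function.Bijective (lTensorHomToHomLTensor (.id R) K F A) := by
  obtain ⟨n, m, p, q, hp, hq⟩ := Module.FinitePresentation.exists_fin' R K
  have h (n : ℕ) : Function.Bijective (lTensorHomToHomLTensor (.id R) (Fin n → R) F A) := by
    rw [← lTensorHomEquivHomLTensor_toLinearMap]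
    exact LinearEquiv.bijective _
  exact LinearMap.bijective_of_bijective_of_injective_of_left_exact
    ((p.lcomp R A).lTensor F) ((q.lcomp R A).lTensor F)
    (p.lcomp R (F ⊗[R] A)) (q.lcomp R (F ⊗[R] A)) _ _ _
    (lTensorHomToHomLTensor_naturality p) (lTensorHomToHomLTensor_naturality q)
    (Module.Flat.lTensor_exact F (LinearMap.exact_lcomp_of_exact_of_surjective _ hq hp))
    (LinearMap.exact_lcomp_of_exact_of_surjective _ hq hp)
    (h n) (h m).1
    (Module.Flat.lTensor_preserves_injective_linearMap _
      (LinearMap.lcomp_injective_of_surjective p hp))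
    (LinearMap.lcomp_injective_of_surjective p hp)

end

section Flat

variable {A B D : Type u} [AddCommGroup A] [AddCommGroup B] [AddCommGroup D]
  [Module R A] [Module R B] [Module R D] {f : A →ₗ[R] B} {g : B →ₗ[R] D}

theorem isSES_ker (hg : Function.Surjective g) : IsSES (LinearMap.ker g).subtype g :=
  ⟨Subtype.val_injective, LinearMap.exact_subtype_ker_map g, hg⟩

theorem isSES_range (hf : Function.Injective f) : IsSES f (LinearMap.range f).mkQ :=
  ⟨hf, LinearMap.exact_map_mkQ_range f, Submodule.mkQ_surjective _⟩

namespace IsSES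

theorem rTensor_injective_of_flat (h : IsSES f g) (hD : Module.Flat R D) (K : Type u)
    [AddCommGroup K] [Module R K] : Function.Injective (f.rTensor K) :=
  (LinearMap.lTensor_inj_iff_rTensor_inj K f).1
    (LinearMap.lTensor_injective_of_exact_of_flat g h.surj f h.inj h.exact K)

theorem lTensor_of_flat (h : IsSES f g) (F : Type u) [AddCommGroup F] [Module R F]
    [Module.Flat R F] : IsSES (f.lTensor F) (g.lTensor F) :=
  ⟨Module.Flat.lTensor_preserves_injective_linearMap f h.inj, lTensor_exact F h.exact h.surj,
    LinearMap.lTensor_surjective F h.surj⟩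

theorem flat_left (h : IsSES f g) (hB : Module.Flat R B) (hD : Module.Flat R D) :
    Module.Flat R A := by
  refine Module.Flat.iff_lTensor_injective'.2 fun I => ?_
  have h1 : Function.Injective ((f.rTensor R).comp (I.subtype.lTensor A)) := by
    rw [LinearMap.rTensor_comp_lTensor, ← LinearMap.lTensor_comp_rTensor]
    exact (Module.Flat.iff_lTensor_injective'.1 hB I).comp (h.rTensor_injective_of_flat hD I)
  exact Function.Injective.of_comp h1

/-- The quotient of a flat module by a pure submodule is flat. -/
theorem flat_right (h : IsSES f g) (hB : Module.Flat R B)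
    (hf : ∀ (K : Type u) [AddCommGroup K] [Module R K], Function.Injective (f.rTensor K)) :
    Module.Flat R D := by
  refine Module.Flat.iff_lTensor_injective'.2 fun I =>
    (injective_iff_map_eq_zero _).2 fun x hx => ?_
  obtain ⟨b, rfl⟩ := LinearMap.rTensor_surjective I h.surj x
  have comm {X Y : Type u} [AddCommGroup X] [AddCommGroup Y] [Module R X] [Module R Y]
      {S T : Type u} [AddCommGroup S] [AddCommGroup T] [Module R S] [Module R T]
      (p : X →ₗ[R] Y) (q : S →ₗ[R] T) (z) :
      q.lTensor Y (p.rTensor S z) = p.rTensor T (q.lTensor X z) := by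
    rw [← LinearMap.comp_apply, ← LinearMap.comp_apply, LinearMap.lTensor_comp_rTensor,
      LinearMap.rTensor_comp_lTensor]
  rw [comm] at hx
  obtain ⟨a, ha⟩ := (rTensor_exact R h.exact h.surj _).1 hx
  have hI (X : Type u) [AddCommGroup X] [Module R X] :
      Function.Exact (I.subtype.lTensor X) (I.mkQ.lTensor X) :=
    lTensor_exact X (LinearMap.exact_subtype_mkQ I) (Submodule.mkQ_surjective I)
  obtain ⟨a, rfl⟩ := (hI A a).1 (hf _ (by
    rw [← comm, ha, (hI B).apply_apply_eq_zero, map_zero]))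
  rw [← comm] at ha
  rw [← Module.Flat.iff_lTensor_injective'.1 hB I ha,
    (rTensor_exact I h.exact h.surj).apply_apply_eq_zero]

end IsSES

theorem ExtVanish.of_flat [Module.Flat R A] : ExtVanish R A (CharacterModule B) := by
  refine ExtVanish.of_forall_presentation (fun A => Module.Flat R A) (fun D hD => ?_)
    (ModuleCat.of R A) ‹_›
  have h := isSES_ker (Finsupp.linearCombination_id_surjective R D)
  refine ⟨ModuleCat.of R (LinearMap.ker _), ModuleCat.of R (D →₀ R), _, _,
    h.flat_left inferInstance hD, h, ExtVanish.of_projective, ?_⟩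
  rw [← rTensor_injective_iff_forall_exists]
  exact h.rTensor_injective_of_flat hD B

variable (R A) in
/-- `A⁺ ≅ Hom(A, R⁺)`. -/
noncomputable def characterModuleEquiv : CharacterModule A ≃ₗ[R] (A →ₗ[R] CharacterModule R) :=
  (CharacterModule.congr (TensorProduct.rid R A).symm).trans CharacterModule.homEquiv.symm

instance : Module.Injective R (CharacterModule R) :=
  Module.Flat.iff_characterModule_injective.1 inferInstance

theorem flat_hom_of_injective [IsNoetherianRing R] [Module.Injective R A] [Module.Injective R D] :
    Module.Flat R (A →ₗ[R] D) := by
  refine Module.Flat.iff_rTensor_injective'.2 fun I => ?_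
  have : Module.FinitePresentation R I := Module.finitePresentation_of_finite R I
  refine Function.Injective.of_comp (f := tensorHomEval R A D R) ?_
  rw [← LinearMap.coe_comp, ← tensorHomEval_naturality, LinearMap.coe_comp]
  exact (LinearMap.lcomp_injective_of_surjective _
    (lcomp_surjective_of_injective I.subtype_injective)).comp (tensorHomEval_bijective I).1

theorem flat_characterModule_of_injective [IsNoetherianRing R] [Module.Injective R A] :
    Module.Flat R (CharacterModule A) :=
  have : Module.Flat R (A →ₗ[R] CharacterModule R) := flat_hom_of_injective
  Module.Flat.of_linearEquiv (characterModuleEquiv R A)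

variable (R A) in
/-- The natural map `A → A⁺⁺`. -/
def doubleDual : A →ₗ[R] CharacterModule (CharacterModule A) where
  toFun a :=
    { toFun := fun c => c a
      map_zero' := rfl
      map_add' := fun _ _ => rfl }
  map_add' a b := by
    ext c; exact map_add c a b
  map_smul' r a := by
    ext c; rfl

theorem rTensor_doubleDual_injective (K : Type u) [AddCommGroup K] [Module R K] :
    Function.Injective ((doubleDual R A).rTensor K) := by
  rw [rTensor_injective_iff_forall_exists]
  intro a
  refine ⟨(CharacterModule.dual (doubleDual R K)).comp
    (CharacterModule.dual (CharacterModule.dual a)), ?_⟩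
  ext x k
  rfl

theorem doubleDual_injective : Function.Injective (doubleDual R A) :=
  (injective_iff_map_eq_zero _).2 fun _ ha =>
    CharacterModule.eq_zero_of_character_apply fun c => DFunLike.congr_fun ha c

end Flat

end TensorHom

section CFlat

variable {R : Type u} [CommRing R] {C : ModuleCat.{u} R}

section

variable {A B D : Type u} [AddCommGroup A] [AddCommGroup B] [AddCommGroup D]
  [Module R A] [Module R B] [Module R D] {f : A →ₗ[R] B} {g : B →ₗ[R] D}

theorem IsSES.congr_right (h : IsSES f g) {D' : Type u} [AddCommGroup D'] [Module R D']
    (e : D ≃ₗ[R] D') : IsSES f (e.toLinearMap.comp g) :=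
  ⟨h.inj, e.injective.comp_exact_iff_exact.2 h.exact, e.surjective.comp h.surj⟩

theorem IsSES.congr_middle (h : IsSES f g) {B' : Type u} [AddCommGroup B'] [Module R B']
    (e : B ≃ₗ[R] B') : IsSES (e.toLinearMap.comp f) (g.comp e.symm.toLinearMap) where
  inj := e.injective.comp h.inj
  exact := fun b => by
    have := h.exact (e.symm b)
    simp only [LinearMap.comp_apply, LinearEquiv.coe_coe, this, Set.mem_range, e.eq_symm_apply]
  surj := h.surj.comp e.symm.surjective

theorem IsSES.congr_left (h : IsSES f g) {A' : Type u} [AddCommGroup A'] [Module R A']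
    (e : A' ≃ₗ[R] A) : IsSES (f.comp e.toLinearMap) g :=
  ⟨h.inj.comp e.injective, e.surjective.comp_exact_iff_exact.2 h.exact, h.surj⟩

theorem flat_prod (hA : Module.Flat R A) (hB : Module.Flat R B) : Module.Flat R (A × B) := by
  refine Module.Flat.iff_lTensor_injective'.2 fun I => ?_
  have h : (TensorProduct.prodLeft R R A B R).toLinearMap.comp (I.subtype.lTensor (A × B)) =
      ((I.subtype.lTensor A).prodMap (I.subtype.lTensor B)).comp
        (TensorProduct.prodLeft R R A B I).toLinearMap := by
    ext <;> simp
  refine Function.Injective.of_comp (f := (TensorProduct.prodLeft R R A B R).toLinearMap) ?_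
  rw [← LinearMap.coe_comp, h]
  exact ((Module.Flat.iff_lTensor_injective'.1 hA I).prodMap
    (Module.Flat.iff_lTensor_injective'.1 hB I)).comp (LinearEquiv.injective _)

/-- `Hom(K, I)⁺ ≅ I⁺ ⊗ K` for `K` finitely presented and `I` injective. -/
noncomputable def characterModuleHomEquiv (K I : Type u) [AddCommGroup K] [Module R K]
    [AddCommGroup I] [Module R I] [Module.FinitePresentation R K] [Module.Injective R I] :
    CharacterModule (K →ₗ[R] I) ≃ₗ[R] CharacterModule I ⊗[R] K :=
  (characterModuleEquiv R _).trans <|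
    (LinearEquiv.ofBijective _
      (tensorHomEval_bijective (A := I) (E := CharacterModule R) K)).symm.trans <|
    (TensorProduct.comm R _ _).trans ((characterModuleEquiv R I).symm.rTensor K)

/-- A presentation of a finite module, over a noetherian ring, whose syzygy inherits the vanishing
of `Ext`. -/
theorem exists_finite_presentation [IsNoetherianRing R] (K N : Type u) [AddCommGroup K]
    [Module R K] [AddCommGroup N] [Module R N] [Module.Finite R K] (hK : ExtVanish R K N) :
    ∃ (n : ℕ) (K' : Submodule R (Fin n → R)) (g : (Fin n → R) →ₗ[R] K),
      IsSES K'.subtype g ∧ ExtVanish R K' N := by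
  obtain ⟨n, g, hg⟩ := Module.Finite.exists_fin' R K
  exact ⟨n, LinearMap.ker g, g, isSES_ker hg, .left_of_ses (isSES_ker hg) .of_projective hK⟩

/-- `Tor_i(F ⊗ K, Hom(N, I)) = 0` if `F` is flat, `Ext^i(K, N) = 0` and `I` is injective. -/
theorem extVanish_tensor_characterModule [IsNoetherianRing R] (F K N I : Type u) [AddCommGroup F]
    [Module R F] [AddCommGroup K] [Module R K] [AddCommGroup N] [Module R N] [AddCommGroup I]
    [Module R I] [Module.Flat R F] [Module.Finite R K] (hK : ExtVanish R K N)
    [Module.Injective R I] : ExtVanish R (F ⊗[R] K) (CharacterModule (N →ₗ[R] I)) := by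
  refine ExtVanish.of_forall_presentation (fun D => ∃ K : ModuleCat.{u} R, Module.Finite R K ∧
    ExtVanish R K N ∧ Nonempty ((F ⊗[R] K) ≃ₗ[R] D)) ?_ (ModuleCat.of R (F ⊗[R] K))
    ⟨ModuleCat.of R K, ‹_›, hK, ⟨.refl _ _⟩⟩
  rintro D ⟨K, hf, hK, ⟨e⟩⟩
  obtain ⟨n, K', g, h, hK'⟩ := exists_finite_presentation K N hK
  refine ⟨ModuleCat.of R (F ⊗[R] K'), ModuleCat.of R (F ⊗[R] (Fin n → R)), _, _,
    ⟨ModuleCat.of R K', inferInstanceAs (Module.Finite R K'), hK', ⟨.refl _ _⟩⟩,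
    (h.lTensor_of_flat F).congr_right e, .of_flat, ?_⟩
  rw [← rTensor_injective_iff_forall_exists]
  have : Module.FinitePresentation R K' := Module.finitePresentation_of_finite R K'
  have h1 : Function.Injective (K'.subtype.rTensor (N →ₗ[R] I)) := by
    refine Function.Injective.of_comp (f := tensorHomEval R N I (Fin n → R)) ?_
    rw [← LinearMap.coe_comp, ← tensorHomEval_naturality, LinearMap.coe_comp]
    exact (LinearMap.lcomp_injective_of_surjective (K'.subtype.lcomp R N)
      (h.exists_extension hK)).comp
      (tensorHomEval_bijective K').1
  have h2 := Module.Flat.lTensor_preserves_injective_linearMap (M := F) _ h1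
  have h3 : (TensorProduct.assoc R F (Fin n → R) (N →ₗ[R] I)).toLinearMap.comp
      ((K'.subtype.lTensor F).rTensor (N →ₗ[R] I)) =
      ((K'.subtype.rTensor (N →ₗ[R] I)).lTensor F).comp
        (TensorProduct.assoc R F K' (N →ₗ[R] I)).toLinearMap := by
    ext; rfl
  refine Function.Injective.of_comp (f := TensorProduct.assoc R F (Fin n → R) (N →ₗ[R] I)) ?_
  have := h2.comp (f := (TensorProduct.assoc R F K' (N →ₗ[R] I)).toLinearMap)
    (TensorProduct.assoc R F K' (N →ₗ[R] I)).injective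
  rw [← LinearMap.coe_comp, ← h3] at this
  exact this

/-- `Ext^i(K, F ⊗ N) = 0` if `F` is flat, `K` is finite and `Ext^i(K, N) = 0`. -/
theorem extVanish_tensor_right [IsNoetherianRing R] (F K N : Type u) [AddCommGroup F]
    [Module R F] [AddCommGroup K] [Module R K] [AddCommGroup N] [Module R N]
    [Module.Flat R F] [Module.Finite R K] (hK : ExtVanish R K N) :
    ExtVanish R K (F ⊗[R] N) := by
  refine ExtVanish.of_forall_presentation (fun K => Module.Finite R K ∧ ExtVanish R K N) ?_
    (ModuleCat.of R K) ⟨‹_›, hK⟩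
  rintro K ⟨hf, hK⟩
  obtain ⟨n, K', g, h, hK'⟩ := exists_finite_presentation K N hK
  refine ⟨ModuleCat.of R K', ModuleCat.of R (Fin n → R), _, _,
    ⟨inferInstanceAs (Module.Finite R K'), hK'⟩, h, .of_projective, fun a => ?_⟩
  have : Module.FinitePresentation R K' := Module.finitePresentation_of_finite R K'
  obtain ⟨x, rfl⟩ := (lTensorHomToHomLTensor_bijective F K' N).2 a
  obtain ⟨y, rfl⟩ := LinearMap.lTensor_surjective F
    (g := K'.subtype.lcomp R N) (h.exists_extension hK) x
  exact ⟨lTensorHomToHomLTensor (.id R) _ F N y,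
    LinearMap.congr_fun (lTensorHomToHomLTensor_naturality K'.subtype) y⟩

end

section

variable {M N : ModuleCat.{u} R}

theorem IsCFlat.prod (hM : IsCFlat R C M) (hN : IsCFlat R C N) :
    IsCFlat R C (ModuleCat.of R (M × N)) := by
  obtain ⟨F, hF, ⟨e⟩⟩ := hM
  obtain ⟨G, hG, ⟨e'⟩⟩ := hN
  exact ⟨ModuleCat.of R (F × G), flat_prod hF hG,
    ⟨(e.prodCongr e').trans (TensorProduct.prodLeft R R F G C).symm⟩⟩

theorem evalMap_naturality (g : M →ₗ[R] N) :
    (evalMap R C N).comp ((g.compRight (M := C) R).lTensor C) = g.comp (evalMap R C M) := by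
  ext; rfl

theorem InBassClass.of_linearEquiv (h : InBassClass R C M) (e : M ≃ₗ[R] N) :
    InBassClass R C N := by
  obtain ⟨h1, h2, h3⟩ := h
  rw [extZero_iff] at h1
  rw [torZero_iff] at h2
  let e' : (C →ₗ[R] M) ≃ₗ[R] (C →ₗ[R] N) := e.congrRight
  refine ⟨(extZero_iff _ _).2 (h1.of_linearEquiv_right e),
    (torZero_iff _ _).2 (h2.of_linearEquiv_left e'), ?_⟩
  refine (Function.Bijective.of_comp_iff _ (e'.lTensor C).bijective).1 ?_
  have : (evalMap R C N) ∘ (e'.lTensor C) = e ∘ (evalMap R C M) :=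
    congrArg DFunLike.coe (evalMap_naturality (C := C) e.toLinearMap)
  rw [this]
  exact e.bijective.comp h3

/-- `C`-flat modules lie in the Bass class. -/
theorem IsCFlat.inBassClass [IsNoetherianRing R] (hC : IsSemidualizing R C) (h : IsCFlat R C M) :
    InBassClass R C M := by
  obtain ⟨F, hF, ⟨e⟩⟩ := h
  obtain ⟨hfin, hbij, hext⟩ := hC
  have : Module.FinitePresentation R C := Module.finitePresentation_of_finite R C
  let φ : F →ₗ[R] (C →ₗ[R] F ⊗[R] C) := TensorProduct.mk R F C
  have hφ : Function.Bijective φ := by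
    have h1 : φ = ((lTensorHomToHomLTensor (.id R) C F C).comp
        ((LinearMap.lsmul R C).lTensor F)).comp (TensorProduct.rid R F).symm.toLinearMap := by
      ext x c; simp [φ]
    rw [h1]
    refine ((lTensorHomToHomLTensor_bijective (R := R) F C C).comp
      ((LinearEquiv.ofBijective (LinearMap.lsmul R C) hbij).lTensor (F : Type u)).bijective).comp
      (TensorProduct.rid R F).symm.bijective
  have key : InBassClass R C (ModuleCat.of R (F ⊗[R] C)) := by
    refine ⟨(extZero_iff _ _).2 (extVanish_tensor_right F C C ((extZero_iff _ _).1 hext)),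
      (torZero_iff _ _).2 (.of_linearEquiv_left (LinearEquiv.ofBijective φ hφ) .of_flat), ?_⟩
    refine (Function.Bijective.of_comp_iff _
      ((LinearEquiv.ofBijective φ hφ).lTensor (C : Type u)).bijective).1 ?_
    have h1 : (evalMap R C (ModuleCat.of R (F ⊗[R] C))).comp (φ.lTensor C) =
        (TensorProduct.comm R C F).toLinearMap := by
      ext; rfl
    have h2 := congrArg DFunLike.coe h1
    rw [LinearMap.coe_comp] at h2
    refine (h2 : _ = _).symm ▸ (TensorProduct.comm R C F).bijective
  exact key.of_linearEquiv e.symm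

/-- The character module of a `C`-injective module is `C`-flat. -/
theorem IsCInjective.isCFlat_characterModule [IsNoetherianRing R] (hC : IsSemidualizing R C)
    (h : IsCInjective R C M) : IsCFlat R C (ModuleCat.of R (CharacterModule M)) := by
  obtain ⟨I, hI, ⟨e⟩⟩ := h
  obtain ⟨hfin, -⟩ := hC
  have : Module.FinitePresentation R C := Module.finitePresentation_of_finite R C
  exact ⟨ModuleCat.of R (CharacterModule I), flat_characterModule_of_injective,
    ⟨(CharacterModule.congr e).trans (characterModuleHomEquiv C I)⟩⟩

/-- `C`-flat modules are acyclic for tensoring with `C`-injective modules. -/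
theorem IsCFlat.extVanish [IsNoetherianRing R] (hC : IsSemidualizing R C) (h : IsCFlat R C M)
    (hN : IsCInjective R C N) : ExtVanish R M (CharacterModule N) := by
  obtain ⟨F, hF, ⟨e⟩⟩ := h
  obtain ⟨I, hI, ⟨e'⟩⟩ := hN
  obtain ⟨hfin, -, hext⟩ := hC
  exact .of_linearEquiv_left e.symm <| .of_linearEquiv_right (CharacterModule.congr e').symm <|
    extVanish_tensor_characterModule F C C I ((extZero_iff _ _).1 hext)

/-- A `C`-flat module embeds in the character module of a `C`-injective module with `C`-flat
cokernel. -/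
theorem IsCFlat.exists_ses [IsNoetherianRing R] (hC : IsSemidualizing R C) (h : IsCFlat R C M) :
    ∃ (J Q : ModuleCat.{u} R) (f : M →ₗ[R] CharacterModule J) (g : CharacterModule J →ₗ[R] Q),
      IsCInjective R C J ∧ IsCFlat R C Q ∧ IsSES f g := by
  obtain ⟨F, hF, ⟨e⟩⟩ := h
  obtain ⟨hfin, -⟩ := hC
  have : Module.FinitePresentation R C := Module.finitePresentation_of_finite R C
  have hI : Module.Injective R (CharacterModule F) := Module.Flat.iff_characterModule_injective.1 hF
  have hF' := flat_characterModule_of_injective (R := R) (A := CharacterModule F)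
  have h := isSES_range (doubleDual_injective (R := R) (A := F))
  have hG := h.flat_right hF' fun K _ _ => rTensor_doubleDual_injective K
  have h' : IsSES ((doubleDual R F).rTensor C) ((LinearMap.range (doubleDual R F)).mkQ.rTensor C) :=
    ⟨rTensor_doubleDual_injective C, rTensor_exact C h.exact h.surj,
      LinearMap.rTensor_surjective C h.surj⟩
  let ε := (characterModuleHomEquiv (R := R) C (CharacterModule F)).symm
  refine ⟨ModuleCat.of R (C →ₗ[R] CharacterModule F),
    ModuleCat.of R ((_ ⧸ LinearMap.range (doubleDual R F)) ⊗[R] C), _, _,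
    ⟨ModuleCat.of R (CharacterModule F), hI, ⟨.refl _ _⟩⟩,
    ⟨ModuleCat.of R _, hG, ⟨.refl _ _⟩⟩, (h'.congr_middle ε).congr_left e⟩

end
end CFlat

section GCFlat

theorem exists_int_sequence {α : Type*} (r s : α → α → Prop) (U V : α → Prop)
    (hU : ∀ a, U a → ∃ b, U b ∧ r b a) (hV : ∀ a, V a → ∃ b, V b ∧ s a b) {a : α}
    (hUa : U a) (hVa : V a) :
    ∃ T : ℤ → α, T 0 = a ∧ (∀ i, 0 ≤ i → U (T i) ∧ r (T (i + 1)) (T i)) ∧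
      ∀ i < 0, V (T i) ∧ s (T (i + 1)) (T i) := by
  choose! up hup using hU
  choose! down hdown using hV
  have h1 (n : ℕ) : U (up^[n] a) := by
    induction n with
    | zero => exact hUa
    | succ n ih => rw [Function.iterate_succ_apply']; exact (hup _ ih).1
  have h2 (n : ℕ) : V (down^[n] a) := by
    induction n with
    | zero => exact hVa
    | succ n ih => rw [Function.iterate_succ_apply']; exact (hdown _ ih).1
  let T : ℤ → α := fun i => if 0 ≤ i then up^[i.toNat] a else down^[(-i).toNat] a
  have hT1 (n : ℕ) : T n = up^[n] a := by simp [T]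
  have hT2 (n : ℕ) : T (-n) = down^[n] a := by
    rcases Nat.eq_zero_or_pos n with rfl | hn
    · simp [T]
    · simp [T, hn.ne']
  refine ⟨T, by simp [T], fun i hi => ?_, fun i hi => ?_⟩
  · lift i to ℕ using hi
    rw [← Nat.cast_succ, hT1, hT1, Function.iterate_succ_apply']
    exact ⟨h1 _, (hup _ (h1 i)).2⟩
  · obtain ⟨n, rfl⟩ : ∃ n : ℕ, i = -((n + 1 : ℕ) : ℤ) := ⟨(-i - 1).toNat, by lia⟩
    rw [show -((n + 1 : ℕ) : ℤ) + 1 = -n by push_cast; ring, hT2, hT2,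
      Function.iterate_succ_apply']
    exact ⟨(hdown _ (h2 n)).1, (hdown _ (h2 n)).2⟩

variable {R : Type u} [CommRing R] {C : ModuleCat.{u} R}

namespace ZComplex

section

variable {T X : ℤ → ModuleCat.{u} R} {f : ∀ i, T (i + 1) →ₗ[R] X i} {g : ∀ i, X i →ₗ[R] T i}

/-- The complex glued from short exact sequences `0 → T (i + 1) → X i → T i → 0`. -/
def ofSES (h : ∀ i, IsSES (f i) (g i)) : ZComplex R where
  X := X
  d i := (f i).comp (g (i + 1))
  d_comp_d i := by
    ext x
    simp [(h (i + 1)).exact.apply_apply_eq_zero]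

variable (h : ∀ i, IsSES (f i) (g i))

theorem ofSES_isExact : (ofSES h).IsExact := fun i =>
  show Function.Exact ((f (i + 1)).comp (g _)) ((f i).comp (g _)) from
  (h _).inj.comp_exact_iff_exact.2 ((h _).surj.comp_exact_iff_exact.2 (h (i + 1)).exact)

theorem ofSES_tensorExact {J : ModuleCat.{u} R}
    (hJ : ∀ i, Function.Injective ((f i).rTensor J)) : (ofSES h).TensorExact J := fun i => by
  have : Function.Exact ((f (i + 1)).rTensor J ∘ₗ (g (i + 1 + 1)).rTensor J)
      ((f i).rTensor J ∘ₗ (g (i + 1)).rTensor J) :=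
    (hJ i).comp_exact_iff_exact.2 ((LinearMap.rTensor_surjective J
      (h _).surj).comp_exact_iff_exact.2 (rTensor_exact J (h (i + 1)).exact (h (i + 1)).surj))
  rwa [← LinearMap.rTensor_comp, ← LinearMap.rTensor_comp] at this

theorem ofSES_isCokerOfD1 : (ofSES h).IsCokerOfD1 (T 0) := by
  have h0 : LinearMap.range ((f 0).comp (g (0 + 1))) = LinearMap.ker (g 0) := by
    rw [LinearMap.exact_iff.1 (h 0).exact]
    exact LinearMap.range_comp_of_range_eq_top _ (LinearMap.range_eq_top.2 (h (0 + 1)).surj)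
  exact ⟨((Submodule.quotEquivOfEq _ _ h0).trans
    (LinearMap.quotKerEquivOfSurjective _ (h 0).surj)).symm⟩

end

section

variable (Z : ZComplex R)

/-- The `i`-th cokernel `X i / im (d i)` of a complex. -/
def cycle (i : ℤ) : ModuleCat.{u} R := ModuleCat.of R (Z.X i ⧸ LinearMap.range (Z.d i))

variable {Z}

/-- The inclusion `X (i + 1) / im (d (i + 1)) → X i` in an exact complex. -/
noncomputable def cycleι (h : Z.IsExact) (i : ℤ) : Z.cycle (i + 1) →ₗ[R] Z.X i := cokerMap (h i)

variable (Z) in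
/-- The projection `X i → X i / im (d i)`. -/
def cycleπ (i : ℤ) : Z.X i →ₗ[R] Z.cycle i := (LinearMap.range (Z.d i)).mkQ

theorem cycleι_comp_cycleπ (h : Z.IsExact) (i : ℤ) :
    (cycleι h i).comp (Z.cycleπ (i + 1)) = Z.d i := cokerMap_comp_mkQ _

theorem isSES_cycle (h : Z.IsExact) (i : ℤ) : IsSES (cycleι h i) (Z.cycleπ i) :=
  isSES_cokerMap (h i)

end

end ZComplex

variable (C) in
/-- `Tor_i(N, J) = 0` for all `i ≥ 1` and all `C`-injective `J`. -/
def TorAcyclic (N : ModuleCat.{u} R) : Prop :=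
  ∀ J : ModuleCat.{u} R, IsCInjective R C J → ExtVanish R N (CharacterModule J)

variable {M N : ModuleCat.{u} R}

theorem TorAcyclic.of_linearEquiv (h : TorAcyclic C M) (e : M ≃ₗ[R] N) : TorAcyclic C N :=
  fun J hJ => (h J hJ).of_linearEquiv_left e

theorem TorAcyclic.exists_flat_ses (h : TorAcyclic C M) :
    ∃ N, TorAcyclic C N ∧ ∃ (F : ModuleCat.{u} R) (f : N →ₗ[R] F) (g : F →ₗ[R] M),
      Module.Flat R F ∧ IsSES f g := by
  have hs := isSES_ker (Finsupp.linearCombination_id_surjective R M)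
  refine ⟨ModuleCat.of R _, fun J hJ => .left_of_ses hs .of_projective (h J hJ),
    ModuleCat.of R (M →₀ R), Submodule.subtype _, Finsupp.linearCombination R id,
    inferInstanceAs (Module.Flat R (M →₀ R)), hs⟩

theorem isGCFlat_of_class (S : ModuleCat.{u} R → Prop) (hS : ∀ N, S N → TorAcyclic C N)
    (hS' : ∀ N, S N → ∃ N', S N' ∧ ∃ (Y : ModuleCat.{u} R) (f : N →ₗ[R] Y) (g : Y →ₗ[R] N'),
      IsCFlat R C Y ∧ IsSES f g) (hM : S M) : IsGCFlat R C M := by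
  obtain ⟨T, rfl, hT, hT'⟩ := exists_int_sequence _ _ (TorAcyclic C) S
    (fun N hN => TorAcyclic.exists_flat_ses hN) hS' (hS _ hM) hM
  have hX (i : ℤ) : ∃ (X : ModuleCat.{u} R) (f : T (i + 1) →ₗ[R] X) (g : X →ₗ[R] T i),
      IsSES f g ∧ (0 ≤ i → Module.Flat R X) ∧ (i < 0 → IsCFlat R C X) := by
    rcases lt_or_ge i 0 with hi | hi
    · obtain ⟨-, X, f, g, hX, h⟩ := hT' i hi
      exact ⟨X, f, g, h, fun hi' => absurd hi hi'.not_gt, fun _ => hX⟩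
    · obtain ⟨-, X, f, g, hX, h⟩ := hT i hi
      exact ⟨X, f, g, h, fun _ => hX, fun hi' => absurd hi hi'.not_ge⟩
  choose X f g h hX1 hX2 using hX
  refine ⟨.ofSES h, ZComplex.ofSES_isExact h, hX1, hX2, fun J hJ =>
    ZComplex.ofSES_tensorExact h fun i => rTensor_injective_iff_forall_exists.2 fun a =>
      (h i).exists_extension ?_ a, ZComplex.ofSES_isCokerOfD1 h⟩
  rcases lt_or_ge i 0 with hi | hi
  · exact hS _ (hT' i hi).1 J hJ
  · exact (hT i hi).1 J hJ

theorem ZComplex.exists_extension_of_tensorExact {Z : ZComplex R} (h : Z.IsExact)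
    {J : ModuleCat.{u} R} (hJ : Z.TensorExact J) (i : ℤ)
    (a : Z.cycle (i + 1) →ₗ[R] CharacterModule J) :
    ∃ b : Z.X i →ₗ[R] CharacterModule J, b.comp (cycleι h i) = a :=
  rTensor_injective_iff_forall_exists.1 ((rTensor_exact_iff (h i)).1 (hJ i)) a

theorem IsGCFlat.of_linearEquiv (h : IsGCFlat R C M) (e : M ≃ₗ[R] N) : IsGCFlat R C N := by
  obtain ⟨Z, h1, h2, h3, h4, ⟨e'⟩⟩ := h
  exact ⟨Z, h1, h2, h3, h4, ⟨e.symm.trans e'⟩⟩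

theorem IsCFlat.of_subsingleton [Subsingleton M] : IsCFlat R C M :=
  ⟨ModuleCat.of R PUnit.{u + 1}, inferInstanceAs (Module.Flat R PUnit.{u + 1}),
    ⟨LinearEquiv.ofSubsingleton M (PUnit.{u + 1} ⊗[R] C)⟩⟩

variable [IsNoetherianRing R]

theorem IsCFlat.torAcyclic (hC : IsSemidualizing R C) (h : IsCFlat R C M) : TorAcyclic C M :=
  fun _ hJ => h.extVanish hC hJ

theorem IsGCFlat.exists_class (hC : IsSemidualizing R C) (h : IsGCFlat R C M) :
    ∃ S : ModuleCat.{u} R → Prop, (∀ N, S N → TorAcyclic C N) ∧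
      (∀ N, S N → ∃ N', S N' ∧ ∃ (Y : ModuleCat.{u} R) (f : N →ₗ[R] Y) (g : Y →ₗ[R] N'),
        IsCFlat R C Y ∧ IsSES f g) ∧ S M := by
  obtain ⟨Z, hZ, hF, hCF, hT, ⟨e⟩⟩ := h
  have hacyc (i : ℤ) : TorAcyclic C (Z.cycle i) := fun J hJ => by
    refine ExtVanish.of_forall_presentation (fun N => ∃ i, N = Z.cycle i) ?_ _ ⟨i, rfl⟩
    rintro _ ⟨i, rfl⟩
    refine ⟨_, _, _, _, ⟨i + 1, rfl⟩, Z.isSES_cycle hZ i, ?_,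
      ZComplex.exists_extension_of_tensorExact hZ (hT J hJ) i⟩
    rcases lt_or_ge i 0 with hi | hi
    · exact (hCF i hi).extVanish hC hJ
    · have := hF i hi
      exact .of_flat
  refine ⟨fun N => ∃ i ≤ 0, Nonempty (N ≃ₗ[R] Z.cycle i), ?_, ?_, 0, le_rfl, ⟨e⟩⟩
  · rintro N ⟨i, -, ⟨e⟩⟩
    exact (hacyc i).of_linearEquiv e.symm
  · rintro N ⟨i, hi, ⟨e⟩⟩
    obtain ⟨j, rfl⟩ : ∃ j, i = j + 1 := ⟨i - 1, by ring⟩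
    exact ⟨Z.cycle j, ⟨j, by lia, ⟨.refl _ _⟩⟩, Z.X j, _, _, hCF j (by lia),
      (Z.isSES_cycle hZ j).congr_left e⟩

theorem IsGCFlat.torAcyclic (hC : IsSemidualizing R C) (h : IsGCFlat R C M) : TorAcyclic C M := by
  obtain ⟨S, hS, -, hM⟩ := h.exists_class hC
  exact hS _ hM

theorem IsGCFlat.exists_ses (hC : IsSemidualizing R C) (h : IsGCFlat R C M) :
    ∃ (Y N : ModuleCat.{u} R) (f : M →ₗ[R] Y) (g : Y →ₗ[R] N),
      IsCFlat R C Y ∧ IsGCFlat R C N ∧ IsSES f g := by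
  obtain ⟨S, hS, hS', hM⟩ := h.exists_class hC
  obtain ⟨N, hN, Y, f, g, hY, h⟩ := hS' M hM
  exact ⟨Y, N, f, g, hY, isGCFlat_of_class S hS hS' hN, h⟩

theorem IsCFlat.isGCFlat (hC : IsSemidualizing R C) (h : IsCFlat R C M) : IsGCFlat R C M := by
  refine isGCFlat_of_class (IsCFlat R C) (fun _ hN => hN.torAcyclic hC) (fun N hN => ?_) h
  exact ⟨ModuleCat.of R PUnit.{u + 1}, .of_subsingleton, N, LinearMap.id, 0, hN,
    Function.injective_id, fun x => ⟨fun _ => ⟨x, rfl⟩, fun _ => rfl⟩, fun _ => ⟨0, rfl⟩⟩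

end GCFlat

section ExtClosure

variable {R : Type u} [CommRing R]

section

variable {A B D : Type u} [AddCommGroup A] [AddCommGroup B] [AddCommGroup D]
  [Module R A] [Module R B] [Module R D] {f : A →ₗ[R] B} {g : B →ₗ[R] D}

theorem IsSES.exists_factor (h : IsSES f g) {P : Type*} [AddCommGroup P] [Module R P]
    {φ : B →ₗ[R] P} (hφ : φ.comp f = 0) : ∃ ψ : D →ₗ[R] P, ψ.comp g = φ := by
  have hker : LinearMap.ker g ≤ LinearMap.ker φ := by
    rw [LinearMap.exact_iff.1 h.exact]
    rintro _ ⟨a, rfl⟩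
    exact LinearMap.congr_fun hφ a
  refine ⟨((LinearMap.ker g).liftQ φ hker).comp
    (LinearMap.quotKerEquivOfSurjective g h.surj).symm.toLinearMap, LinearMap.ext fun b => ?_⟩
  have hb : (LinearMap.quotKerEquivOfSurjective g h.surj).symm (g b) = (LinearMap.ker g).mkQ b :=
    (LinearEquiv.symm_apply_eq _).2 rfl
  simp [hb]

/-- The quotient of the target of a composite of two monomorphisms. -/
theorem IsSES.exists_comp (h : IsSES f g) {E Q : Type u} [AddCommGroup E] [AddCommGroup Q]
    [Module R E] [Module R Q] {k : B →ₗ[R] E} {q : E →ₗ[R] Q} (h' : IsSES k q) :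
    ∃ (P : ModuleCat.{u} R) (φ : E →ₗ[R] P) (ψ : D →ₗ[R] P) (ρ : P →ₗ[R] Q),
      IsSES (k.comp f) φ ∧ IsSES ψ ρ := by
  have hφ := isSES_range (f := k.comp f) (h'.inj.comp h.inj)
  set φ := (LinearMap.range (k.comp f)).mkQ
  obtain ⟨ψ, hψ⟩ := h.exists_factor (φ := φ.comp k)
    (LinearMap.ext fun a => hφ.exact.apply_apply_eq_zero a)
  obtain ⟨ρ, hρ⟩ := hφ.exists_factor (φ := q)
    (LinearMap.ext fun a => h'.exact.apply_apply_eq_zero (f a))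
  replace hψ (b : B) : ψ (g b) = φ (k b) := LinearMap.congr_fun hψ b
  replace hρ (x : E) : ρ (φ x) = q x := LinearMap.congr_fun hρ x
  refine ⟨ModuleCat.of R _, φ, ψ, ρ, hφ, ?_, fun x => ⟨fun hx => ?_, ?_⟩, fun x => ?_⟩
  · refine (injective_iff_map_eq_zero ψ).2 fun d hd => ?_
    obtain ⟨b, rfl⟩ := h.surj d
    obtain ⟨a, ha⟩ := (hφ.exact _).1 ((hψ b).symm.trans hd)
    rw [← h'.inj ha]
    exact h.exact.apply_apply_eq_zero a
  · obtain ⟨x, rfl⟩ := hφ.surj x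
    obtain ⟨b, rfl⟩ := (h'.exact x).1 ((hρ x).symm.trans hx)
    exact ⟨g b, hψ b⟩
  · rintro ⟨d, rfl⟩
    obtain ⟨b, rfl⟩ := h.surj d
    rw [hψ, hρ]
    exact h'.exact.apply_apply_eq_zero b
  · obtain ⟨y, rfl⟩ := h'.surj x
    exact ⟨φ y, hρ y⟩

/-- The horseshoe lemma for monomorphisms. -/
theorem IsSES.exists_horseshoe (h : IsSES f g) {Y A' Z D' : Type u} [AddCommGroup Y]
    [AddCommGroup A'] [AddCommGroup Z] [AddCommGroup D'] [Module R Y] [Module R A'] [Module R Z]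
    [Module R D'] {k : A →ₗ[R] Y} {p : Y →ₗ[R] A'} (hA : IsSES k p)
    {l : D →ₗ[R] Z} {q : Z →ₗ[R] D'} (hD : IsSES l q) {b : B →ₗ[R] Y} (hb : b.comp f = k) :
    ∃ (B' : ModuleCat.{u} R) (φ : B →ₗ[R] Y × Z) (ψ : Y × Z →ₗ[R] B') (α : A' →ₗ[R] B')
      (β : B' →ₗ[R] D'), IsSES φ ψ ∧ IsSES α β := by
  replace hb (a : A) : b (f a) = k a := LinearMap.congr_fun hb a
  let φ : B →ₗ[R] Y × Z := b.prod (l.comp g)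
  have hφ : Function.Injective φ := (injective_iff_map_eq_zero φ).2 fun x hx => by
    have h1 : b x = 0 := congrArg Prod.fst hx
    have h2 : l (g x) = 0 := congrArg Prod.snd hx
    obtain ⟨a, rfl⟩ := (h.exact x).1 ((map_eq_zero_iff l hD.inj).1 h2)
    rw [hb] at h1
    rw [(map_eq_zero_iff k hA.inj).1 h1, map_zero]
  have hψ := isSES_range hφ
  set ψ := (LinearMap.range φ).mkQ
  have hφf (a : A) : φ (f a) = (k a, 0) := by
    simp [φ, hb, h.exact.apply_apply_eq_zero a]
  obtain ⟨α, hα⟩ := hA.exists_factor (φ := ψ.comp (LinearMap.inl R Y Z)) (LinearMap.ext fun a => by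
    simpa [hφf] using hψ.exact.apply_apply_eq_zero (f a))
  obtain ⟨β, hβ⟩ := hψ.exists_factor (φ := q.comp (LinearMap.snd R Y Z))
    (LinearMap.ext fun x => hD.exact.apply_apply_eq_zero (g x))
  replace hα (y : Y) : α (p y) = ψ (y, 0) := LinearMap.congr_fun hα y
  replace hβ (y : Y) (z : Z) : β (ψ (y, z)) = q z := LinearMap.congr_fun hβ (y, z)
  refine ⟨ModuleCat.of R _, φ, ψ, α, β, hψ, ?_, fun x => ⟨fun hx => ?_, ?_⟩, fun x => ?_⟩
  · refine (injective_iff_map_eq_zero α).2 fun x hx => ?_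
    obtain ⟨y, rfl⟩ := hA.surj x
    obtain ⟨x, hx⟩ := (hψ.exact _).1 ((hα y).symm.trans hx)
    have h1 : b x = y := congrArg Prod.fst hx
    have h2 : l (g x) = 0 := congrArg Prod.snd hx
    obtain ⟨a, rfl⟩ := (h.exact x).1 ((map_eq_zero_iff l hD.inj).1 h2)
    rw [← h1, hb]
    exact hA.exact.apply_apply_eq_zero a
  · obtain ⟨⟨y, z⟩, rfl⟩ := hψ.surj x
    obtain ⟨d, rfl⟩ := (hD.exact z).1 ((hβ y z).symm.trans hx)
    obtain ⟨x, rfl⟩ := h.surj d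
    refine ⟨p (y - b x), ?_⟩
    rw [hα, show ((y - b x, 0) : Y × Z) = (y, l (g x)) - φ x by simp [φ], map_sub,
      hψ.exact.apply_apply_eq_zero x, sub_zero]
  · rintro ⟨a, rfl⟩
    obtain ⟨y, rfl⟩ := hA.surj a
    rw [hα, hβ, map_zero]
  · obtain ⟨z, rfl⟩ := hD.surj x
    exact ⟨ψ (0, z), hβ 0 z⟩

end

/-- The closure of a class of modules under extensions. -/
inductive ExtClosure (P : ModuleCat.{u} R → Prop) : ModuleCat.{u} R → Prop
  | base (M : ModuleCat.{u} R) (hM : P M) : ExtClosure P M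
  | ext (A B D : ModuleCat.{u} R) (f : A →ₗ[R] B) (g : B →ₗ[R] D) (h : IsSES f g)
      (hA : ExtClosure P A) (hD : ExtClosure P D) : ExtClosure P B

variable {C : ModuleCat.{u} R}

variable (C) in
/-- `C`-flat modules `Y` with `Ext^i(N, Y) = 0` for all `i ≥ 1` whenever `N` is Tor-acyclic
with respect to `C`-injective modules. -/
def IsCFlatAcyclic (Y : ModuleCat.{u} R) : Prop :=
  IsCFlat R C Y ∧ ∀ N : ModuleCat.{u} R, TorAcyclic C N → ExtVanish R N Y

theorem IsCFlatAcyclic.prod {Y Z : ModuleCat.{u} R} (hY : IsCFlatAcyclic C Y)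
    (hZ : IsCFlatAcyclic C Z) : IsCFlatAcyclic C (ModuleCat.of R (Y × Z)) :=
  ⟨hY.1.prod hZ.1, fun N hN => .middle_of_ses' (f := LinearMap.inl R Y Z)
    (g := LinearMap.snd R Y Z) ⟨LinearMap.inl_injective, .inl_snd, LinearMap.snd_surjective⟩
    (hY.2 N hN) (hZ.2 N hN)⟩

theorem IsCFlat.exists_acyclic_ses [IsNoetherianRing R] (hC : IsSemidualizing R C)
    {M : ModuleCat.{u} R} (h : IsCFlat R C M) :
    ∃ (Y Q : ModuleCat.{u} R) (f : M →ₗ[R] Y) (g : Y →ₗ[R] Q),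
      IsCFlatAcyclic C Y ∧ IsCFlat R C Q ∧ IsSES f g := by
  obtain ⟨J, Q, f, g, hJ, hQ, h⟩ := h.exists_ses hC
  exact ⟨ModuleCat.of R (CharacterModule J), Q, f, g,
    ⟨hJ.isCFlat_characterModule hC, fun N hN => hN J hJ⟩, hQ, h⟩

/-- If every module of a class embeds in an acyclic `C`-flat module with cokernel in the extension
closure of the class, then the modules of the class are `G_C`-flat. -/
theorem isGCFlat_of_extClosure (P : ModuleCat.{u} R → Prop) (hP : ∀ N, P N → TorAcyclic C N)
    (hP' : ∀ N, P N → ∃ (Y N' : ModuleCat.{u} R) (f : N →ₗ[R] Y) (g : Y →ₗ[R] N'),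
      IsCFlatAcyclic C Y ∧ ExtClosure P N' ∧ IsSES f g)
    {M : ModuleCat.{u} R} (hM : P M) : IsGCFlat R C M := by
  have hacyc (N) (hN : ExtClosure P N) : TorAcyclic C N := by
    induction hN with
    | base N hN => exact hP N hN
    | ext A B D f g h _ _ hA hD => exact fun J hJ => .middle_of_ses h (hA J hJ) (hD J hJ)
  have hses (N) (hN : ExtClosure P N) :
      ∃ (Y N' : ModuleCat.{u} R) (f : N →ₗ[R] Y) (g : Y →ₗ[R] N'),
        IsCFlatAcyclic C Y ∧ ExtClosure P N' ∧ IsSES f g := by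
    induction hN with
    | base N hN => exact hP' N hN
    | ext A B D f g h hA hD ihA ihD =>
      obtain ⟨Y, A', k, p, hY, hA', hk⟩ := ihA
      obtain ⟨Z, D', l, q, hZ, hD', hl⟩ := ihD
      obtain ⟨b, hb⟩ := h.exists_extension (hY.2 D (hacyc D hD)) k
      obtain ⟨B', φ, ψ, α, β, hφ, hα⟩ := h.exists_horseshoe hk hl hb
      exact ⟨ModuleCat.of R (Y × Z), B', φ, ψ, hY.prod hZ, .ext A' B' D' α β hα hA' hD', hφ⟩
  refine isGCFlat_of_class (ExtClosure P) hacyc (fun N hN => ?_) (.base M hM)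
  obtain ⟨Y, N', f, g, hY, hN', h⟩ := hses N hN
  exact ⟨N', hN', Y, f, g, hY.1, h⟩

/-- Let `T` be a class of Tor-acyclic modules such that each of its modules embeds in a `G_C`-flat
module with cokernel in `T`. Then the modules in `T` are `G_C`-flat. -/
theorem isGCFlat_of_gcflat_copresentation [IsNoetherianRing R] (hC : IsSemidualizing R C)
    (T : ModuleCat.{u} R → Prop) (hT : ∀ N, T N → TorAcyclic C N)
    (hT' : ∀ N, T N → ∃ (X N' : ModuleCat.{u} R) (f : N →ₗ[R] X) (g : X →ₗ[R] N'),
      IsGCFlat R C X ∧ T N' ∧ IsSES f g)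
    {M : ModuleCat.{u} R} (hM : T M) : IsGCFlat R C M := by
  let P : ModuleCat.{u} R → Prop := fun N => IsGCFlat R C N ∨ T N
  have hbase (N : ModuleCat.{u} R) (hN : IsGCFlat R C N) :
      ∃ (Y N' : ModuleCat.{u} R) (f : N →ₗ[R] Y) (g : Y →ₗ[R] N'),
        IsCFlatAcyclic C Y ∧ ExtClosure P N' ∧ IsSES f g := by
    obtain ⟨Y, N', f, g, hY, hN', h⟩ := hN.exists_ses hC
    obtain ⟨Y₂, Q, f₂, g₂, hY₂, hQ, h₂⟩ := hY.exists_acyclic_ses hC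
    obtain ⟨K, φ, ψ, ρ, hφ, hψ⟩ := h.exists_comp h₂
    exact ⟨Y₂, K, _, φ, hY₂, .ext N' K Q ψ ρ hψ (.base _ (.inl hN'))
      (.base _ (.inl (hQ.isGCFlat hC))), hφ⟩
  refine isGCFlat_of_extClosure P ?_ ?_ (.inr hM)
  · rintro N (hN | hN)
    · exact hN.torAcyclic hC
    · exact hT N hN
  · rintro N (hN | hN)
    · exact hbase N hN
    · obtain ⟨X, N', f, g, hX, hN', h⟩ := hT' N hN
      obtain ⟨Y, Q, f₂, g₂, hY, hQ, h₂⟩ := hbase X hX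
      obtain ⟨K, φ, ψ, ρ, hφ, hψ⟩ := h.exists_comp h₂
      exact ⟨Y, K, _, φ, hY, .ext N' K Q ψ ρ hψ (.base _ (.inr hN')) hQ, hφ⟩

end ExtClosure

section GClass

variable {R : Type u} [CommRing R] {C : ModuleCat.{u} R}

namespace ZComplex

variable {Z : ZComplex R} {V : ModuleCat.{u} R}

theorem HomFromExact.exists_lift (hV : Z.HomFromExact V) (h : Z.IsExact) (i : ℤ)
    (a : V →ₗ[R] Z.cycle i) : ∃ b : V →ₗ[R] Z.X i, (Z.cycleπ i).comp b = a := by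
  obtain ⟨k, rfl⟩ : ∃ k, i = k + 1 + 1 := ⟨i - 1 - 1, by ring⟩
  obtain ⟨b, hb⟩ := (hV k ((cycleι h (k + 1)).comp a)).1 <| by
    rw [← cycleι_comp_cycleπ h k]
    ext x
    simp [(Z.isSES_cycle h (k + 1)).exact.apply_apply_eq_zero]
  refine ⟨b, LinearMap.ext fun x => (Z.isSES_cycle h (k + 1)).inj ?_⟩
  have hx := LinearMap.congr_fun hb x
  simp only [← cycleι_comp_cycleπ h (k + 1)] at hx
  exact hx

theorem HomToExact.exists_extension (hV : Z.HomToExact V) (h : Z.IsExact) (i : ℤ)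
    (a : Z.cycle (i + 1) →ₗ[R] V) : ∃ b : Z.X i →ₗ[R] V, b.comp (cycleι h i) = a := by
  obtain ⟨b, hb⟩ := (hV i (a.comp (Z.cycleπ (i + 1)))).1 <| by
    rw [← cycleι_comp_cycleπ h (i + 1)]
    ext x
    simp [(Z.isSES_cycle h (i + 1)).exact.apply_apply_eq_zero]
  refine ⟨b, LinearMap.ext fun x => ?_⟩
  obtain ⟨y, rfl⟩ := (Z.isSES_cycle h (i + 1)).surj x
  have hy := LinearMap.congr_fun hb y
  simp only [← cycleι_comp_cycleπ h i] at hy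
  exact hy

theorem inBassClass_cycle (h : Z.IsExact) (hX : ∀ i, InBassClass R C (Z.X i))
    (hC : Z.HomFromExact C) (i : ℤ) : InBassClass R C (Z.cycle i) := by
  have hses (i : ℤ) := Z.isSES_cycle h i
  have hHom (i : ℤ) : IsSES ((cycleι h i).compRight (M := C) R)
      ((Z.cycleπ i).compRight (M := C) R) := by
    refine ⟨fun a b hab => LinearMap.ext fun x => (hses i).inj (LinearMap.congr_fun hab x),
      fun a => ⟨fun ha => ?_, ?_⟩, hC.exists_lift h i⟩
    · have hr : ∀ x, a x ∈ LinearMap.range (cycleι h i) := fun x =>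
        ((hses i).exact _).1 (LinearMap.congr_fun ha x)
      refine ⟨(LinearEquiv.ofInjective _ (hses i).inj).symm.toLinearMap.comp
        (a.codRestrict _ hr), LinearMap.ext fun x => ?_⟩
      exact congrArg Subtype.val
        ((LinearEquiv.ofInjective _ (hses i).inj).apply_symm_apply ⟨a x, hr x⟩)
    · rintro ⟨b, rfl⟩
      exact LinearMap.ext fun x => (hses i).exact.apply_apply_eq_zero (b x)
  have hev (i : ℤ) : Function.Surjective (evalMap R C (Z.cycle i)) := by
    have := (hses i).surj.comp (hX i).2.2.2
    rw [← LinearMap.coe_comp, ← evalMap_naturality, LinearMap.coe_comp] at this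
    exact this.of_comp
  have hinj (i : ℤ) : Function.Injective (evalMap R C (Z.cycle i)) := by
    refine (injective_iff_map_eq_zero _).2 fun x hx => ?_
    obtain ⟨y, rfl⟩ := LinearMap.lTensor_surjective C (hHom i).surj x
    have hy : Z.cycleπ i (evalMap R C (Z.X i) y) = 0 :=
      (LinearMap.congr_fun (evalMap_naturality (C := C) (Z.cycleπ i)) y).symm.trans hx
    obtain ⟨t, ht⟩ := ((hses i).exact _).1 hy
    obtain ⟨s, rfl⟩ := hev _ t
    have hs := LinearMap.congr_fun (evalMap_naturality (C := C) (cycleι h i)) s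
    rw [← (hX i).2.2.1 (hs.trans ht)]
    exact (lTensor_exact C (hHom i).exact (hHom i).surj).apply_apply_eq_zero s
  have hten (i : ℤ) : Function.Injective (((cycleι h i).compRight (M := C) R).lTensor C) := by
    have := (hses i).inj.comp (hinj (i + 1))
    rw [← LinearMap.coe_comp, ← evalMap_naturality, LinearMap.coe_comp] at this
    exact this.of_comp
  refine ⟨(extZero_iff _ _).2 ?_, (torZero_iff _ _).2 ?_, hinj i, hev i⟩
  · refine ExtVanish.of_forall_copresentation (fun N => ∃ i, N = Z.cycle i) ?_ _ ⟨i, rfl⟩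
    rintro _ ⟨i, rfl⟩
    obtain ⟨j, rfl⟩ : ∃ j, i = j + 1 := ⟨i - 1, by ring⟩
    exact ⟨_, _, _, _, ⟨j, rfl⟩, hses j, (extZero_iff _ _).1 (hX j).1, hC.exists_lift h j⟩
  · refine ExtVanish.of_forall_presentation
      (fun N => ∃ i, N = ModuleCat.of R (C →ₗ[R] Z.cycle i)) ?_ _ ⟨i, rfl⟩
    rintro _ ⟨i, rfl⟩
    exact ⟨_, ModuleCat.of R (C →ₗ[R] Z.X i), _, _, ⟨i + 1, rfl⟩, hHom i,
      (torZero_iff _ _).1 (hX i).2.1, rTensor_injective_iff_forall_exists.1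
        ((LinearMap.lTensor_inj_iff_rTensor_inj _ _).1 (hten i))⟩

end ZComplex

theorem isCFlat_self (C : ModuleCat.{u} R) : IsCFlat R C C :=
  ⟨ModuleCat.of R R, inferInstanceAs (Module.Flat R R), ⟨(TensorProduct.lid R C).symm⟩⟩

theorem isGCFlat_and_inBassClass_of_gclass [IsNoetherianRing R] (hC : IsSemidualizing R C)
    {M : ModuleCat.{u} R} (h : GClass R (fun N => IsGCFlat R C N ∧ InBassClass R C N) M) :
    IsGCFlat R C M ∧ InBassClass R C M := by
  obtain ⟨Z, hZ, hX, hfrom, hto, ⟨e⟩⟩ := h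
  have hflat {N : ModuleCat.{u} R} (hN : IsCFlat R C N) : IsGCFlat R C N ∧ InBassClass R C N :=
    ⟨hN.isGCFlat hC, hN.inBassClass hC⟩
  have hacyc (i : ℤ) : TorAcyclic C (Z.cycle i) := fun J hJ => by
    refine ExtVanish.of_forall_presentation (fun N => ∃ i, N = Z.cycle i) ?_ _ ⟨i, rfl⟩
    rintro _ ⟨i, rfl⟩
    exact ⟨_, _, _, _, ⟨i + 1, rfl⟩, Z.isSES_cycle hZ i, (hX i).1.torAcyclic hC J hJ,
      (hto _ (hflat (hJ.isCFlat_characterModule hC))).exists_extension hZ i⟩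
  have hG : IsGCFlat R C (Z.cycle 0) := by
    refine isGCFlat_of_gcflat_copresentation hC (fun N => ∃ i, N = Z.cycle i) ?_ ?_ ⟨0, rfl⟩
    · rintro _ ⟨i, rfl⟩
      exact hacyc i
    · rintro _ ⟨i, rfl⟩
      obtain ⟨j, rfl⟩ : ∃ j, i = j + 1 := ⟨i - 1, by ring⟩
      exact ⟨Z.X j, _, _, _, (hX j).1, ⟨j, rfl⟩, Z.isSES_cycle hZ j⟩
  exact ⟨hG.of_linearEquiv e.symm, (ZComplex.inBassClass_cycle hZ (fun i => (hX i).2)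
    (hfrom C (hflat (isCFlat_self C))) 0).of_linearEquiv e.symm⟩

theorem gclass_of_mem (P : ModuleCat.{u} R → Prop)
    (hP : ∀ M N : ModuleCat.{u} R, Nonempty (M ≃ₗ[R] N) → P M → P N)
    (hP' : ∀ M : ModuleCat.{u} R, Subsingleton M → P M) {M : ModuleCat.{u} R} (hM : P M) :
    GClass R P M := by
  obtain ⟨T, hT₀, hT⟩ : ∃ T : ℤ → ModuleCat.{u} R, T 0 = M ∧ ∀ i ≠ 0, Subsingleton (T i) :=
    ⟨Function.update (fun _ => ModuleCat.of R PUnit.{u + 1}) 0 M, Function.update_self ..,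
      fun i hi => by
        rw [Function.update_of_ne hi]
        exact inferInstanceAs (Subsingleton PUnit.{u + 1})⟩
  subst hT₀
  let X : ℤ → ModuleCat.{u} R := fun i => ModuleCat.of R (T (i + 1) × T i)
  let f (i : ℤ) : T (i + 1) →ₗ[R] X i := LinearMap.inl R (T (i + 1)) (T i)
  let g (i : ℤ) : X i →ₗ[R] T i := LinearMap.snd R (T (i + 1)) (T i)
  have h (i : ℤ) : IsSES (f i) (g i) :=
    ⟨LinearMap.inl_injective, .inl_snd, LinearMap.snd_surjective⟩
  refine ⟨.ofSES h, ZComplex.ofSES_isExact h, fun i => ?_, fun V hV i φ => ⟨fun hφ => ?_, ?_⟩,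
    fun V hV i φ => ⟨fun hφ => ?_, ?_⟩, ZComplex.ofSES_isCokerOfD1 h⟩
  · change P (ModuleCat.of R (T (i + 1) × T i))
    by_cases hi : i = 0
    · subst hi
      have := hT (0 + 1) (by simp)
      have : Unique (T (0 + 1)) := uniqueOfSubsingleton 0
      exact hP _ _ ⟨LinearEquiv.uniqueProd.symm⟩ hM
    · have := hT i hi
      by_cases hi' : i + 1 = 0
      · have : Unique (T i) := uniqueOfSubsingleton 0
        rw [← hi'] at hM
        exact hP _ _ ⟨LinearEquiv.prodUnique.symm⟩ hM
      · have := hT (i + 1) hi'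
        exact hP' _ (inferInstanceAs (Subsingleton (T (i + 1) × T i)))
  · refine ⟨(LinearMap.inr R (T (i + 1 + 1 + 1)) (T (i + 1 + 1))).comp
      ((LinearMap.fst R (T (i + 1 + 1)) (T (i + 1))).comp φ), LinearMap.ext fun x => ?_⟩
    have hx : (φ x).2 = 0 := congrArg Prod.fst (LinearMap.congr_fun hφ x)
    exact Prod.ext rfl hx.symm
  · rintro ⟨φ, rfl⟩
    rfl
  · refine ⟨(φ.comp (LinearMap.inr R (T (i + 1 + 1)) (T (i + 1)))).comp
      (LinearMap.fst R (T (i + 1)) (T i)), LinearMap.ext fun x => ?_⟩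
    let ψ : T (i + 1 + 1) × T (i + 1) →ₗ[R] V := φ
    have hx : ψ (x.1, 0) = 0 :=
      LinearMap.congr_fun hφ ((0, x.1) : T (i + 1 + 1 + 1) × T (i + 1 + 1))
    have hadd := ψ.map_add (x.1, 0) (0, x.2)
    rw [hx, zero_add, Prod.mk_add_mk, add_zero, zero_add] at hadd
    exact hadd.symm
  · rintro ⟨φ, rfl⟩
    exact LinearMap.ext fun x => map_zero φ

theorem gclass_eq [IsNoetherianRing R] (hC : IsSemidualizing R C) :
    GClass R (fun N => IsGCFlat R C N ∧ InBassClass R C N) =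
      fun N => IsGCFlat R C N ∧ InBassClass R C N := by
  refine funext fun M => propext ⟨isGCFlat_and_inBassClass_of_gclass hC, fun hM => ?_⟩
  refine gclass_of_mem _ ?_ (fun M _ => ?_) hM
  · rintro M N ⟨e⟩ ⟨h1, h2⟩
    exact ⟨h1.of_linearEquiv e, h2.of_linearEquiv e⟩
  · have h : IsCFlat R C M := .of_subsingleton
    exact ⟨h.isGCFlat hC, h.inBassClass hC⟩

end GClass

/-- For `n ≥ 1`, `G^n(GF_C(R) ∩ B_C(R)) = GF_C(R) ∩ B_C(R)`. -/
theorem stmt5 (R : Type u) [CommRing R] [IsNoetherianRing R]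
    (C : ModuleCat.{u} R) (hC : IsSemidualizing R C) (n : ℕ) (hn : 1 ≤ n)
    (M : ModuleCat.{u} R) :
    GIter R n (fun N => IsGCFlat R C N ∧ InBassClass R C N) M ↔
      (IsGCFlat R C M ∧ InBassClass R C M) := by
  have h : GIter R n (fun N => IsGCFlat R C N ∧ InBassClass R C N) =
      fun N => IsGCFlat R C N ∧ InBassClass R C N := by
    clear hn
    induction n with
    | zero => rfl
    | succ n ih => rw [GIter, ih, gclass_eq hC]
  rw [h]
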